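/- arXiv:2103.10523 — 2 statements merged into one kernel-verified Lean document; each statement's English description precedes it below -/
import Mathlib

section
/- Let M and N be positive integers and let k be a natural number with max(M,N) ≥ τ^k. Then any squaring of the rectangle R = [0,M] × [0,N] ⊆ ℝ² into n axis-parallel squares with positive integer side lengths a_1, …, a_n such that at least one tile is a unit square (a_i = 1 for some i) consists of at least k tiles, i.e., n ≥ k. -/
/-- The closed axis-parallel square `[x, x+a] × [y, y+a] ⊆ ℝ²` with lower-left
corner `(x, y)` and side length `a`. -/
def sqTile (x y : ℝ) (a : ℕ) : Set (ℝ × ℝ) :=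
  Set.Icc x (x + a) ×ˢ Set.Icc y (y + a)

/-- An integer matrix with coloured rows, each of whose columns has, within each colour class,
at most one entry `1`, at most one entry `-1`, and zeros elsewhere. -/
structure IsBigraphic {ι κ : Type*} (color : ι → Bool) (D : Matrix ι κ ℤ) : Prop where
  entry : ∀ i e, D i e = -1 ∨ D i e = 0 ∨ D i e = 1
  eq_of_eq : ∀ i j e, color i = color j → D i e = D j e → D i e ≠ 0 → i = j

/-- Pivot on the entry `(i, a)` within the colour class of row `i`, then remove row `i` and
column `a`. -/
def Matrix.colorPivot {n : ℕ} (color : Fin (n + 1) → Bool)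
    (D : Matrix (Fin (n + 1)) (Fin (n + 1)) ℤ) (i a : Fin (n + 1)) :
    Matrix (Fin n) (Fin n) ℤ :=
  Matrix.of fun r e =>
    D (i.succAbove r) (a.succAbove e) +
      (if color (i.succAbove r) = color i then -(D (i.succAbove r) a * D i a) else 0) *
        D i (a.succAbove e)

namespace IsBigraphic

variable {n : ℕ} {color : Fin (n + 1) → Bool} {D : Matrix (Fin (n + 1)) (Fin (n + 1)) ℤ}

theorem neg_of_ne {ι κ : Type*} {color : ι → Bool} {D : Matrix ι κ ℤ}
    (h : IsBigraphic color D) {i j : ι} {e : κ} (hc : color i = color j) (hij : i ≠ j)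
    (hi : D i e ≠ 0) (hj : D j e ≠ 0) : D j e = -D i e := by
  have h1 := h.entry i e
  have h2 := h.entry j e
  have h3 := h.eq_of_eq i j e hc
  grind

theorem colorPivot (h : IsBigraphic color D) (i a : Fin (n + 1)) :
    IsBigraphic (fun r => color (i.succAbove r)) (D.colorPivot color i a) := by
  have key : ∀ r, color (i.succAbove r) = color i →
      -(D (i.succAbove r) a * D i a) = 0 ∨ -(D (i.succAbove r) a * D i a) = 1 := by
    intro r hr
    by_cases h0 : D i a = 0
    · simp [h0]
    by_cases h0' : D (i.succAbove r) a = 0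
    · simp [h0']
    rw [h.neg_of_ne hr.symm (Fin.succAbove_ne i r).symm h0 h0']
    rcases h.entry i a with h1 | h1 | h1 <;> simp [h1]
  have key2 : ∀ r s, color (i.succAbove r) = color i → color (i.succAbove s) = color i →
      -(D (i.succAbove r) a * D i a) = 1 → -(D (i.succAbove s) a * D i a) = 1 → r = s := by
    intro r s hr hs h1 h2
    have h0 : D i a ≠ 0 := by rintro h0; simp [h0] at h1
    have h3 : D (i.succAbove r) a = D (i.succAbove s) a :=
      mul_right_cancel₀ h0 (by linarith)
    refine Fin.succAbove_right_injective (h.eq_of_eq _ _ a (hr.trans hs.symm) h3 ?_)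
    intro h4; simp [h4] at h1
  constructor
  · intro r e
    simp only [Matrix.colorPivot, Matrix.of_apply]
    have h1 := h.entry i (a.succAbove e)
    have h2 := h.entry (i.succAbove r) (a.succAbove e)
    have h3 := h.eq_of_eq i (i.succAbove r) (a.succAbove e)
    have h4 := Fin.succAbove_ne i r
    split_ifs with hc
    · have := key r hc
      grind
    · simpa using h2
  · intro r s e hc
    simp only [Matrix.colorPivot, Matrix.of_apply]
    have h1 := h.entry i (a.succAbove e)
    have h2 := h.entry (i.succAbove r) (a.succAbove e)
    have h2' := h.entry (i.succAbove s) (a.succAbove e)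
    have h3 := h.eq_of_eq i (i.succAbove r) (a.succAbove e)
    have h3' := h.eq_of_eq i (i.succAbove s) (a.succAbove e)
    have h5 := h.eq_of_eq (i.succAbove r) (i.succAbove s) (a.succAbove e) hc
    have h4 := Fin.succAbove_ne i r
    have h4' := Fin.succAbove_ne i s
    have h6 : i.succAbove r = i.succAbove s → r = s := fun h => Fin.succAbove_right_injective h
    by_cases hr : color (i.succAbove r) = color i
    · have hs := hc.symm.trans hr
      have k1 := key r hr
      have k2 := key s hs
      have k3 := key2 r s hr hs
      rw [if_pos hr, if_pos hs]
      generalize -(D (i.succAbove r) a * D i a) = u at *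
      generalize -(D (i.succAbove s) a * D i a) = v at *
      grind
    · have hs : ¬ color (i.succAbove s) = color i := fun hs => hr (hc.trans hs)
      rw [if_neg hr, if_neg hs]
      simp only [zero_mul, add_zero]
      exact fun x y => h6 (h5 x y)

/-- The determinant with column `a` restricted to one colour class is, up to sign, that of the
pivoted matrix. -/
theorem abs_det_updateCol (h : IsBigraphic color D) {i a : Fin (n + 1)} (hia : D i a ≠ 0) :
    |(D.updateCol a fun r => if color r = color i then D r a else 0).det| =
      |(D.colorPivot color i a).det| := by
  set B := D.updateCol a fun r => if color r = color i then D r a else 0 with hB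
  let c : Fin (n + 1) → ℤ := fun r =>
    if color r = color i ∧ r ≠ i then -(D r a * D i a) else 0
  let A : Matrix (Fin (n + 1)) (Fin (n + 1)) ℤ := Matrix.of fun r e => B r e + c r * B i e
  have hdet : A.det = B.det :=
    Matrix.det_eq_of_forall_row_eq_smul_add_const c i (by simp [c]) fun _ _ => rfl
  have hsq : D i a * D i a = 1 := by
    rcases h.entry i a with h1 | h1 | h1 <;> simp_all
  have hcol : ∀ r, r ≠ i → A r a = 0 := by
    intro r hr
    by_cases hc : color r = color i
    · simp [A, c, hB, hc, hr, mul_assoc, hsq]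
    · simp [A, c, hB, hc]
  have hpiv : A i a = D i a := by simp [A, c, hB]
  have hsub : A.submatrix i.succAbove a.succAbove = D.colorPivot color i a := by
    ext r e
    simp [A, c, hB, Matrix.colorPivot, Matrix.updateCol_apply, Fin.succAbove_ne]
  rw [← hdet, Matrix.det_succ_column A a, Finset.sum_eq_single i, hpiv, hsub]
  · have : |D i a| = 1 := by rcases h.entry i a with h1 | h1 | h1 <;> simp_all
    simp [abs_mul, this]
  · intro r _ hr
    simp [hcol r hr]
  · simp

/-- Deletion–contraction inequality. -/
theorem abs_det_le (h : IsBigraphic color D) {i a : Fin (n + 1)} (hia : D i a ≠ 0) :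
    |D.det| ≤ |(D.colorPivot color i a).det| ∨
      ∃ k, color k ≠ color i ∧ D k a ≠ 0 ∧
        |D.det| ≤ |(D.colorPivot color i a).det| + |(D.colorPivot color k a).det| := by
  have hsplit : D.det = (D.updateCol a fun r => if color r = color i then D r a else 0).det +
      (D.updateCol a fun r => if color r ≠ color i then D r a else 0).det := by
    rw [← Matrix.det_updateCol_add]
    congr 1
    ext r e
    by_cases he : e = a
    · subst he
      by_cases hc : color r = color i <;> simp [hc]
    · simp [he]
  by_cases hk : ∃ k, color k ≠ color i ∧ D k a ≠ 0
  · obtain ⟨k, hkc, hka⟩ := hk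
    refine Or.inr ⟨k, hkc, hka, ?_⟩
    have hiff : ∀ r, color r ≠ color i ↔ color r = color k := by
      intro r
      revert hkc
      cases color r <;> cases color k <;> cases color i <;> simp
    rw [← h.abs_det_updateCol hia, ← h.abs_det_updateCol hka, hsplit]
    simp_rw [hiff]
    exact abs_add_le _ _
  · left
    push Not at hk
    rw [← h.abs_det_updateCol hia, hsplit,
      Matrix.det_eq_zero_of_column_eq_zero (A := D.updateCol a
        fun r => if color r ≠ color i then D r a else 0) a, add_zero]
    intro r
    simpa using hk r

/-- A nonsingular bigraphic matrix has a row with at most three nonzero entries. -/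
theorem exists_sparse_row (h : IsBigraphic color D) (hdet : D.det ≠ 0) :
    ∃ i, (Finset.univ.filter fun e => D i e ≠ 0).card ≤ 3 := by
  by_contra! hlt
  have hcol : ∀ e b, (Finset.univ.filter fun i => D i e ≠ 0 ∧ color i = b).card ≤ 2 := by
    intro e b
    by_contra! h3
    obtain ⟨i, j, k, hi, hj, hk, hij, hik, hjk⟩ := Finset.two_lt_card_iff.1 h3
    simp only [Finset.mem_filter, Finset.mem_univ, true_and] at hi hj hk
    have h1 := h.neg_of_ne (hi.2.trans hj.2.symm) hij hi.1 hj.1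
    have h2 := h.neg_of_ne (hi.2.trans hk.2.symm) hik hi.1 hk.1
    exact hjk (h.eq_of_eq j k e (hj.2.trans hk.2.symm) (h1.trans h2.symm) hj.1)
  have hsplit : ∀ e, (Finset.univ.filter fun i => D i e ≠ 0).card =
      (Finset.univ.filter fun i => D i e ≠ 0 ∧ color i = true).card +
      (Finset.univ.filter fun i => D i e ≠ 0 ∧ color i = false).card := by
    intro e
    rw [← Finset.card_filter_add_card_filter_not (fun i => color i = true)]
    simp [Finset.filter_filter]
  have hdouble : ∑ i, (Finset.univ.filter fun e => D i e ≠ 0).card =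
      ∑ e, (Finset.univ.filter fun i => D i e ≠ 0).card := by
    simp_rw [Finset.card_filter]
    exact Finset.sum_comm
  have hfull : ∀ e b, (Finset.univ.filter fun i => D i e ≠ 0 ∧ color i = b).card = 2 := by
    by_contra! hne
    obtain ⟨e, b, hb⟩ := hne
    have h1 : ∑ e, (Finset.univ.filter fun i => D i e ≠ 0).card <
        ∑ _e : Fin (n + 1), 4 := by
      refine Finset.sum_lt_sum (fun e _ => ?_) ⟨e, Finset.mem_univ _, ?_⟩
      · rw [hsplit]; have := hcol e true; have := hcol e false; omega
      · rw [hsplit]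
        have := hcol e true; have := hcol e false
        cases b <;> omega
    have h2 : ∑ _i : Fin (n + 1), 4 ≤ ∑ i, (Finset.univ.filter fun e => D i e ≠ 0).card :=
      Finset.sum_le_sum fun i _ => hlt i
    omega
  apply hdet
  refine Matrix.exists_vecMul_eq_zero_iff.1 ⟨fun i => if color i = true then 1 else 0, ?_, ?_⟩
  · obtain ⟨i, hi⟩ := Finset.card_pos.1 (by rw [hfull 0 true]; norm_num :
      0 < (Finset.univ.filter fun i => D i 0 ≠ 0 ∧ color i = true).card)
    intro h0
    have := congrFun h0 i
    simp_all
  · ext e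
    obtain ⟨i, j, hij, hs⟩ := Finset.card_eq_two.1 (hfull e true)
    have hi : D i e ≠ 0 ∧ color i = true := by
      have : i ∈ Finset.univ.filter fun i => D i e ≠ 0 ∧ color i = true := by simp [hs]
      simpa using this
    have hj : D j e ≠ 0 ∧ color j = true := by
      have : j ∈ Finset.univ.filter fun i => D i e ≠ 0 ∧ color i = true := by simp [hs]
      simpa using this
    have hsum : ∑ r ∈ ({i, j} : Finset (Fin (n + 1))), D r e = 0 := by
      rw [Finset.sum_pair hij, h.neg_of_ne (hi.2.trans hj.2.symm) hij hi.1 hj.1]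
      ring
    rw [← hs, Finset.sum_filter] at hsum
    refine Eq.trans ?_ hsum
    simp only [Matrix.vecMul, dotProduct]
    refine Finset.sum_congr rfl fun r _ => ?_
    by_cases h1 : D r e = 0 <;> by_cases h2 : color r = true <;> simp [h1, h2]

/-- Bound for a matrix with a row of small support, given a bound for all smaller matrices. -/
theorem abs_det_le_of_sparse_row {t : ℝ} (ht : 1 < t) (d : ℕ) : ∀ {n : ℕ}
    {color : Fin n → Bool} {D : Matrix (Fin n) (Fin n) ℤ}, IsBigraphic color D →
    (∀ m < n, ∀ (color' : Fin m → Bool) (D' : Matrix (Fin m) (Fin m) ℤ),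
      IsBigraphic color' D' → |(D'.det : ℝ)| ≤ t ^ m) →
    ∀ i, (Finset.univ.filter fun e => D i e ≠ 0).card ≤ d →
    |(D.det : ℝ)| ≤ t ^ n * ∑ j ∈ Finset.range d, (t⁻¹) ^ (j + 1) := by
  have ht0 : (0 : ℝ) < t := by linarith
  induction d with
  | zero =>
    intro n color D _ _ i hi
    rw [Matrix.det_eq_zero_of_row_eq_zero i]
    · simp
    · intro e
      by_contra he
      have : e ∈ Finset.univ.filter fun e => D i e ≠ 0 := by simpa using he
      rw [Finset.card_eq_zero.1 (Nat.le_zero.1 hi)] at this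
      simp at this
  | succ d ih =>
    intro n color D h hbound i hi
    have hnonneg : ∀ d, 0 ≤ ∑ j ∈ Finset.range d, (t⁻¹) ^ (j + 1) :=
      fun d => Finset.sum_nonneg fun _ _ => by positivity
    by_cases hdet : D.det = 0
    · rw [hdet]
      simpa using mul_nonneg (by positivity) (hnonneg (d + 1))
    obtain ⟨a, ha⟩ : ∃ a, D i a ≠ 0 := by
      by_contra! h0
      exact hdet (Matrix.det_eq_zero_of_row_eq_zero i h0)
    obtain _ | n := n
    · exact i.elim0
    have hexp : t ^ (n + 1) * ∑ j ∈ Finset.range (d + 1), (t⁻¹) ^ (j + 1) =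
        t ^ n + t ^ n * ∑ j ∈ Finset.range d, (t⁻¹) ^ (j + 1) := by
      have hstep : ∑ j ∈ Finset.range d, (t⁻¹) ^ (j + 1 + 1) =
          t⁻¹ * ∑ j ∈ Finset.range d, (t⁻¹) ^ (j + 1) := by
        rw [Finset.mul_sum]
        exact Finset.sum_congr rfl fun _ _ => by ring
      rw [Finset.sum_range_succ', hstep]
      have h1 : t * t⁻¹ = 1 := mul_inv_cancel₀ ht0.ne'
      linear_combination
        (t ^ n * (∑ j ∈ Finset.range d, (t⁻¹) ^ (j + 1)) + t ^ n) * h1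
    rw [hexp]
    have hcon : |((D.colorPivot color i a).det : ℝ)| ≤ t ^ n :=
      hbound n (by omega) _ _ (h.colorPivot i a)
    rcases h.abs_det_le ha with hle | ⟨k, hkc, hka, hle⟩
    · have hle' : |(D.det : ℝ)| ≤ |((D.colorPivot color i a).det : ℝ)| := by exact_mod_cast hle
      have := mul_nonneg (pow_nonneg ht0.le n) (hnonneg d)
      linarith
    · have hle' : |(D.det : ℝ)| ≤ |((D.colorPivot color i a).det : ℝ)| +
          |((D.colorPivot color k a).det : ℝ)| := by exact_mod_cast hle
      obtain ⟨i', rfl⟩ := Fin.exists_succAbove_eq (x := i) (y := k) (by rintro rfl; exact hkc rfl)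
      have hdel := ih (h.colorPivot k a) (fun m hm => hbound m (by omega)) i' (by
        have hrow : ∀ e, D.colorPivot color k a i' e = D (k.succAbove i') (a.succAbove e) := by
          intro e
          simp [Matrix.colorPivot, hkc.symm]
        simp_rw [hrow]
        have hlt : ((Finset.univ.filter fun e => D (k.succAbove i') (a.succAbove e) ≠ 0).map
            a.succAboveEmb).card <
            (Finset.univ.filter fun e => D (k.succAbove i') e ≠ 0).card := by
          refine Finset.card_lt_card ⟨?_, fun hsub => ?_⟩
          · intro e he
            simp only [Finset.mem_map, Finset.mem_filter, Finset.mem_univ, true_and] at he ⊢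
            obtain ⟨e, he, rfl⟩ := he
            exact he
          · have := hsub (show a ∈ _ by simpa using ha)
            simp [Fin.succAbove_ne] at this
        rw [Finset.card_map] at hlt
        omega)
      linarith

theorem abs_det_le_pow {t : ℝ} (ht : 1 < t) (ht3 : t ^ 2 + t + 1 ≤ t ^ 3) (n : ℕ) :
    ∀ (color : Fin n → Bool) (D : Matrix (Fin n) (Fin n) ℤ), IsBigraphic color D →
      |(D.det : ℝ)| ≤ t ^ n := by
  induction n using Nat.strong_induction_on with
  | _ n ih =>
    intro color D h
    have ht0 : (0 : ℝ) < t := by linarith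
    by_cases hdet : D.det = 0
    · rw [hdet]; simp; positivity
    obtain _ | n := n
    · simp
    obtain ⟨i, hi⟩ := h.exists_sparse_row hdet
    refine (h.abs_det_le_of_sparse_row ht 3 ih i hi).trans ?_
    refine mul_le_of_le_one_right (by positivity) ?_
    simp only [Finset.sum_range_succ, Finset.sum_range_zero]
    have h1 : t⁻¹ + t⁻¹ ^ 2 + t⁻¹ ^ 3 = (t ^ 2 + t + 1) / t ^ 3 := by field_simp
    rw [zero_add, zero_add, pow_one, h1, div_le_one (by positivity)]
    exact ht3

end IsBigraphic

/-- If the rows of an integer matrix are linearly independent over `ℝ`, some of its columns form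
a nonsingular square matrix. -/
theorem Matrix.exists_det_submatrix_ne_zero {L : Type*} [Fintype L] [DecidableEq L] {n : ℕ}
    (A : Matrix L (Fin n) ℤ)
    (h : ∀ z : L → ℝ, (∀ i, ∑ l, z l * (A l i : ℝ) = 0) → z = 0) :
    ∃ f : L → Fin n, Function.Injective f ∧ (A.submatrix id f).det ≠ 0 := by
  let A' : Matrix L (Fin n) ℝ := A.map (Int.castRingHom ℝ)
  have hinj : Function.Injective A'.transpose.mulVecLin := by
    rw [← LinearMap.ker_eq_bot, LinearMap.ker_eq_bot']
    intro z hz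
    refine h z fun i => ?_
    have : Matrix.vecMul z A' i = 0 := by simpa using congrFun hz i
    simpa [A', Matrix.vecMul, dotProduct] using this
  have hrank : A'.transpose.rank = Fintype.card L := by
    rw [Matrix.rank, LinearMap.finrank_range_of_inj hinj, Module.finrank_pi]
  have hspan : Submodule.span ℝ (Set.range A'.transpose.row) = ⊤ := by
    apply Submodule.eq_top_of_finrank_eq
    rw [← Matrix.rank_eq_finrank_span_row, hrank, Module.finrank_pi]
  obtain ⟨κ, g, hg, hgspan, hli⟩ := exists_linearIndependent' ℝ A'.transpose.row
  rw [hspan] at hgspan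
  let b := Module.Basis.mk hli hgspan.ge
  let e : L ≃ κ := (Pi.basisFun ℝ L).indexEquiv b
  refine ⟨g ∘ e, hg.comp e.injective, fun hdet => ?_⟩
  have hli' : LinearIndependent ℝ ((A'.submatrix id (g ∘ e)).transpose.row) :=
    hli.comp e e.injective
  rw [Matrix.linearIndependent_rows_iff_isUnit, Matrix.isUnit_transpose,
    Matrix.isUnit_iff_isUnit_det] at hli'
  apply hli'.ne_zero
  have : A'.submatrix id (g ∘ e) = (Int.castRingHom ℝ).mapMatrix (A.submatrix id (g ∘ e)) := rfl
  rw [this, ← RingHom.map_det, hdet, map_zero]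

theorem IsBigraphic.abs_det_le_pow_card {L : Type*} [Fintype L] [DecidableEq L] {t : ℝ}
    (ht : 1 < t) (ht3 : t ^ 2 + t + 1 ≤ t ^ 3) {color : L → Bool} {D : Matrix L L ℤ}
    (h : IsBigraphic color D) : |(D.det : ℝ)| ≤ t ^ Fintype.card L := by
  let e := (Fintype.equivFin L).symm
  have := IsBigraphic.abs_det_le_pow ht ht3 _ (color ∘ e) (D.submatrix e e)
    ⟨fun _ _ => h.entry _ _, fun i j a hc hD h0 => e.injective (h.eq_of_eq _ _ _ hc hD h0)⟩
  rwa [Matrix.det_submatrix_equiv_self] at this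

/-- If a linear system with bigraphic coefficient matrix and right-hand side divisible by `N`
has a unique solution, and an integer combination of its coordinates is `1`, then `N` is small. -/
theorem IsBigraphic.le_pow_of_solution {L : Type*} [Fintype L] [DecidableEq L] {n : ℕ} {t : ℝ}
    (ht : 1 < t) (ht3 : t ^ 2 + t + 1 ≤ t ^ 3) {color : L → Bool} {A : Matrix L (Fin n) ℤ}
    (hA : IsBigraphic color A)
    (hinj : ∀ z : L → ℝ, (∀ i, ∑ l, z l * (A l i : ℝ) = 0) → z = 0)
    {N : ℕ} {z : L → ℝ} {u : Fin n → ℤ} (hz : ∀ i, ∑ l, z l * (A l i : ℝ) = N * u i)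
    {q : L → ℤ} (hq : ∑ l, z l * (q l : ℝ) = 1) : (N : ℝ) ≤ t ^ n := by
  obtain ⟨f, hf, hdet⟩ := A.exists_det_submatrix_ne_zero hinj
  set B := A.submatrix id f with hB
  have hBg : IsBigraphic color B := ⟨fun _ _ => hA.entry _ _, fun i j a => hA.eq_of_eq i j _⟩
  let B' : Matrix L L ℝ := (Int.castRingHom ℝ).mapMatrix B
  let u' : L → ℤ := fun l => u (f l)
  have h1 : Matrix.vecMul z B' = (N : ℝ) • fun l => (u' l : ℝ) := by
    ext l
    simpa [Matrix.vecMul, dotProduct, B', hB, u'] using hz (f l)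
  have hadj : B'.adjugate = (Int.castRingHom ℝ).mapMatrix B.adjugate :=
    ((Int.castRingHom ℝ).map_adjugate B).symm
  have hdet' : B'.det = (B.det : ℝ) := ((Int.castRingHom ℝ).map_det B).symm
  have h2 : (B.det : ℝ) • z =
      (N : ℝ) • fun l => ((Matrix.vecMul u' B.adjugate l : ℤ) : ℝ) := by
    have := congrArg (fun v => Matrix.vecMul v B'.adjugate) h1
    simp only [Matrix.vecMul_vecMul, Matrix.mul_adjugate, Matrix.vecMul_smul, Matrix.vecMul_one,
      Matrix.smul_vecMul, hdet'] at this
    rw [this]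
    congr 1
    ext l
    simp [hadj, Matrix.vecMul, dotProduct]
  have h3 : B.det = N * ∑ l, Matrix.vecMul u' B.adjugate l * q l := by
    have h4 : (B.det : ℝ) = N * ∑ l, ((Matrix.vecMul u' B.adjugate l : ℤ) : ℝ) * (q l : ℝ) := by
      calc (B.det : ℝ) = B.det * ∑ l, z l * (q l : ℝ) := by rw [hq, mul_one]
        _ = _ := by
          rw [Finset.mul_sum, Finset.mul_sum]
          refine Finset.sum_congr rfl fun l _ => ?_
          have := congrFun h2 l
          simp only [Pi.smul_apply, smul_eq_mul] at this
          rw [← mul_assoc, this, mul_assoc]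
    exact_mod_cast h4
  have h5 : (N : ℤ) ≤ |B.det| :=
    Int.le_of_dvd (abs_pos.2 hdet) ((dvd_abs _ _).2 ⟨_, h3⟩)
  have h6 : (N : ℝ) ≤ |(B.det : ℝ)| := by exact_mod_cast h5
  refine h6.trans ((hBg.abs_det_le_pow_card ht ht3).trans (pow_le_pow_right₀ ht.le ?_))
  simpa using Fintype.card_le_of_injective f hf

open MeasureTheory in
theorem Polynomial.setIntegral_Icc_derivative (P : Polynomial ℝ) {a b : ℝ} (hab : a ≤ b) :
    ∫ s in Set.Icc a b, P.derivative.eval s = P.eval b - P.eval a := by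
  rw [integral_Icc_eq_integral_Ioc, ← intervalIntegral.integral_of_le hab]
  exact intervalIntegral.integral_eq_sub_of_hasDerivAt (fun s _ => P.hasDerivAt s)
    (P.derivative.continuous.intervalIntegrable _ _)

/-- The squares `[x i, x i + a i] × [y i, y i + a i]` tile the rectangle `[0, M] × [0, N]`. -/
structure IsSquaring {ι : Type*} (M N : ℝ) (x y a : ι → ℝ) : Prop where
  pos : ∀ i, 0 < a i
  x_nonneg : ∀ i, 0 ≤ x i
  x_le : ∀ i, x i + a i ≤ M
  y_nonneg : ∀ i, 0 ≤ y i
  y_le : ∀ i, y i + a i ≤ N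
  disj : ∀ i j, ∀ p q, p ∈ Set.Ioo (x i) (x i + a i) → p ∈ Set.Ioo (x j) (x j + a j) →
    q ∈ Set.Ioo (y i) (y i + a i) → q ∈ Set.Ioo (y j) (y j + a j) → i = j
  cover : ∀ p ∈ Set.Icc 0 M, ∀ q ∈ Set.Icc 0 N,
    ∃ i, p ∈ Set.Icc (x i) (x i + a i) ∧ q ∈ Set.Icc (y i) (y i + a i)

namespace IsSquaring

variable {ι : Type*} {M N : ℝ} {x y a : ι → ℝ}

theorem swap (h : IsSquaring M N x y a) : IsSquaring N M y x a where
  pos := h.pos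
  x_nonneg := h.y_nonneg
  x_le := h.y_le
  y_nonneg := h.x_nonneg
  y_le := h.x_le
  disj i j p q h1 h2 h3 h4 := h.disj i j q p h3 h4 h1 h2
  cover p hp q hq := by
    obtain ⟨i, h1, h2⟩ := h.cover q hq p hp
    exact ⟨i, h2, h1⟩

/-- Every left side that is not on the boundary is collinear with some right side. -/
theorem exists_right_eq [Finite ι] (h : IsSquaring M N x y a) {i : ι} (hi : 0 < x i) :
    ∃ j, x j + a j = x i := by
  have := Fintype.ofFinite ι
  classical
  have ha := h.pos i
  have hy0 := h.y_nonneg i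
  have hyN := h.y_le i
  have hxM := h.x_le i
  let q := y i + a i / 2
  have hq : q ∈ Set.Icc 0 N := by constructor <;> simp only [q] <;> linarith
  let S : Finset ι := Finset.univ.filter fun j => x j < x i ∧ q ∈ Set.Icc (y j) (y j + a j)
  have hS : S.Nonempty := by
    obtain ⟨k, hk1, hk2⟩ := h.cover (x i / 2) ⟨by linarith, by linarith⟩ q hq
    exact ⟨k, by simp only [S, Finset.mem_filter, Finset.mem_univ, true_and]
                 exact ⟨by linarith [hk1.1], hk2⟩⟩
  obtain ⟨j, hj, hmax⟩ := S.exists_max_image (fun j => x j + a j) hS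
  simp only [S, Finset.mem_filter, Finset.mem_univ, true_and] at hj hmax
  refine ⟨j, ?_⟩
  have haj := h.pos j
  rcases lt_trichotomy (x j + a j) (x i) with hlt | heq | hgt
  · have hxj := h.x_nonneg j
    obtain ⟨k, hk1, hk2⟩ := h.cover ((x j + a j + x i) / 2) ⟨by linarith, by linarith⟩ q hq
    have := hmax k ⟨by linarith [hk1.1], hk2⟩
    linarith [hk1.2]
  · exact heq
  · exfalso
    obtain ⟨p, hp1, hp2⟩ := exists_between (lt_min hgt (show x i < x i + a i by linarith))
    obtain ⟨s, hs1, hs2⟩ := exists_between (show max (y i) (y j) < min (y i + a i) (y j + a j) by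
      have h1 := hj.2.1
      have h2 := hj.2.2
      simp only [q] at h1 h2
      refine max_lt (lt_min ?_ ?_) (lt_min ?_ ?_) <;> linarith)
    rw [lt_min_iff] at hp2 hs2
    rw [max_lt_iff] at hs1
    have := h.disj i j p s ⟨hp1, hp2.2⟩ ⟨hj.1.trans hp1, hp2.1⟩ ⟨hs1.1, hs2.1⟩ ⟨hs1.2, hs2.2⟩
    subst this
    exact lt_irrefl _ hj.1

theorem eq_of_forall_right_eq [Finite ι] (h : IsSquaring M N x y a) (f : ℝ → ℝ)
    (hf : ∀ i, f (x i + a i) = f (x i)) (i : ι) : f (x i) = f 0 := by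
  have hwf : WellFounded (InvImage (· < ·) x : ι → ι → Prop) :=
    @Finite.wellFounded_of_trans_of_irrefl _ _ _ ⟨fun _ _ _ => lt_trans⟩ ⟨fun _ => lt_irrefl _⟩
  induction i using hwf.induction with
  | _ i ih =>
    rcases (h.x_nonneg i).eq_or_lt with h0 | h0
    · rw [← h0]
    · obtain ⟨j, hj⟩ := h.exists_right_eq h0
      rw [← hj, hf]
      exact ih j (by simp only [InvImage]; linarith [h.pos j])

open MeasureTheory in
theorem sum_polynomial [Fintype ι] (h : IsSquaring M N x y a) (hM : 0 ≤ M) (hN : 0 ≤ N)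
    (P Q : Polynomial ℝ) :
    ∑ i, (P.eval (x i + a i) - P.eval (x i)) * (Q.eval (y i + a i) - Q.eval (y i)) =
      (P.eval M - P.eval 0) * (Q.eval N - Q.eval 0) := by
  have hrect : ∀ {l r b t : ℝ}, l ≤ r → b ≤ t →
      ∫ z in Set.Icc l r ×ˢ Set.Icc b t, P.derivative.eval z.1 * Q.derivative.eval z.2 =
        (P.eval r - P.eval l) * (Q.eval t - Q.eval b) := by
    intro l r b t hlr hbt
    rw [Measure.volume_eq_prod, setIntegral_prod_mul (fun s => P.derivative.eval s)
      (fun s => Q.derivative.eval s), P.setIntegral_Icc_derivative hlr,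
      Q.setIntegral_Icc_derivative hbt]
  have hcover : Set.Icc 0 M ×ˢ Set.Icc 0 N =
      ⋃ i, Set.Icc (x i) (x i + a i) ×ˢ Set.Icc (y i) (y i + a i) := by
    ext ⟨p, q⟩
    simp only [Set.mem_prod, Set.mem_iUnion]
    constructor
    · rintro ⟨hp, hq⟩
      exact h.cover p hp q hq
    · rintro ⟨i, hp, hq⟩
      exact ⟨⟨(h.x_nonneg i).trans hp.1, hp.2.trans (h.x_le i)⟩,
        ⟨(h.y_nonneg i).trans hq.1, hq.2.trans (h.y_le i)⟩⟩
  have hae : ∀ i, Set.Icc (x i) (x i + a i) ×ˢ Set.Icc (y i) (y i + a i)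
      =ᵐ[volume] Set.Ioo (x i) (x i + a i) ×ˢ Set.Ioo (y i) (y i + a i) := fun i =>
    (Measure.set_prod_ae_eq Ioo_ae_eq_Icc Ioo_ae_eq_Icc).symm
  rw [← hrect hM hN, hcover, integral_iUnion_ae, tsum_fintype]
  · refine Finset.sum_congr rfl fun i _ => (hrect ?_ ?_).symm <;> linarith [h.pos i]
  · exact fun i => (measurableSet_Icc.prod measurableSet_Icc).nullMeasurableSet
  · intro i j hij
    refine AEDisjoint.congr (Disjoint.aedisjoint ?_) (hae i) (hae j)
    rw [Set.disjoint_left]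
    rintro ⟨p, q⟩ hi hj
    exact hij (h.disj i j p q hi.1 hj.1 hi.2 hj.2)
  · rw [← hcover]
    refine ContinuousOn.integrableOn_compact (isCompact_Icc.prod isCompact_Icc) ?_
    exact Continuous.continuousOn (by fun_prop)

/-- Arbitrary functions of the coordinates define an additive generalised area. -/
theorem sum_mul_eq [Fintype ι] (h : IsSquaring M N x y a) (hM : 0 ≤ M) (hN : 0 ≤ N)
    (f g : ℝ → ℝ) :
    ∑ i, (f (x i + a i) - f (x i)) * (g (y i + a i) - g (y i)) =
      (f M - f 0) * (g N - g 0) := by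
  classical
  have hinterp : ∀ (S : Finset ℝ) (f : ℝ → ℝ), ∃ P : Polynomial ℝ, ∀ c ∈ S, P.eval c = f c :=
    fun S f => ⟨Lagrange.interpolate S id f, fun c hc =>
      Lagrange.eval_interpolate_at_node f (v := id) (Set.injOn_id _) hc⟩
  obtain ⟨P, hP⟩ := hinterp ({0, M} ∪ Finset.univ.image x ∪
    Finset.univ.image fun i => x i + a i) f
  obtain ⟨Q, hQ⟩ := hinterp ({0, N} ∪ Finset.univ.image y ∪
    Finset.univ.image fun i => y i + a i) g
  rw [← hP 0 (by simp), ← hP M (by simp), ← hQ 0 (by simp), ← hQ N (by simp),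
    ← h.sum_polynomial hM hN P Q]
  refine Finset.sum_congr rfl fun i _ => ?_
  rw [hP (x i) (by simp), hP (x i + a i) (by simp), hQ (y i) (by simp),
    hQ (y i + a i) (by simp)]

/-- The coordinates of a squaring are determined by its combinatorics. -/
theorem eq_zero_of_forall_sub_eq [Fintype ι] (h : IsSquaring M N x y a) (hM : 0 ≤ M)
    (hN : 0 ≤ N) {f g : ℝ → ℝ} (hf : f 0 = 0) (hg : g 0 = 0) (hgN : g N = 0)
    (hfg : ∀ i, f (x i + a i) - f (x i) = g (y i + a i) - g (y i)) (i : ι) :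
    f (x i) = 0 ∧ f (x i + a i) = 0 ∧ g (y i) = 0 ∧ g (y i + a i) = 0 := by
  have hsum := h.sum_mul_eq hM hN f g
  rw [hg, hgN, sub_zero, mul_zero] at hsum
  simp_rw [← hfg] at hsum
  rw [Finset.sum_eq_zero_iff_of_nonneg fun i _ => mul_self_nonneg _] at hsum
  have hf' : ∀ i, f (x i + a i) = f (x i) := fun i =>
    sub_eq_zero.1 (mul_self_eq_zero.1 (hsum i (Finset.mem_univ i)))
  have hg' : ∀ i, g (y i + a i) = g (y i) := fun i => by
    linarith [hfg i, hf' i]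
  have h1 := (h.eq_of_forall_right_eq f hf' i).trans hf
  have h2 := (h.swap.eq_of_forall_right_eq g hg' i).trans hg
  exact ⟨h1, (hf' i).trans h1, h2, (hg' i).trans h2⟩

end IsSquaring

open Classical in
theorem Finset.sum_coe_mul_ite_eq (S : Finset ℝ) (z : S → ℝ) (p : ℝ) :
    ∑ c, z c * (if p = c then 1 else 0) = if h : p ∈ S then z ⟨p, h⟩ else 0 := by
  split_ifs with h
  · rw [Finset.sum_eq_single ⟨p, h⟩]
    · simp
    · intro c _ hc
      rw [if_neg fun h' => hc (Subtype.ext h'.symm), mul_zero]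
    · simp
  · refine Finset.sum_eq_zero fun c _ => ?_
    rw [if_neg fun h' => h (by rw [h']; exact c.2), mul_zero]

open Classical in
theorem IsSquaring.height_le_pow {n M N : ℕ} {x y a : Fin n → ℝ} (h : IsSquaring M N x y a)
    {t : ℝ} (ht : 1 < t) (ht3 : t ^ 2 + t + 1 ≤ t ^ 3) (hunit : ∃ i, a i = 1) :
    (N : ℝ) ≤ t ^ n := by
  let X : Finset ℝ := (Finset.univ.image x ∪ Finset.univ.image fun i => x i + a i).erase 0
  let Y : Finset ℝ := ((Finset.univ.image y ∪ Finset.univ.image fun i => y i + a i).erase 0).erase N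
  let A : Matrix (X ⊕ Y) (Fin n) ℤ := Matrix.of fun l i => Sum.elim
    (fun c : X => (if x i + a i = c then 1 else 0) - if x i = c then 1 else 0)
    (fun c : Y => (if y i = c then 1 else 0) - if y i + a i = c then 1 else 0) l
  have hsum : ∀ (z : X ⊕ Y → ℝ) i, ∑ l, z l * (A l i : ℝ) =
      ((if h : x i + a i ∈ X then z (.inl ⟨_, h⟩) else 0) -
        (if h : x i ∈ X then z (.inl ⟨_, h⟩) else 0)) +
      ((if h : y i ∈ Y then z (.inr ⟨_, h⟩) else 0) -
        (if h : y i + a i ∈ Y then z (.inr ⟨_, h⟩) else 0)) := by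
    intro z i
    simp only [Fintype.sum_sum_type, A, Matrix.of_apply, Sum.elim_inl, Sum.elim_inr,
      Int.cast_sub, Int.cast_ite, Int.cast_one, Int.cast_zero, mul_sub, Finset.sum_sub_distrib]
    rw [X.sum_coe_mul_ite_eq (fun c => z (.inl c)), X.sum_coe_mul_ite_eq (fun c => z (.inl c)),
      Y.sum_coe_mul_ite_eq (fun c => z (.inr c)), Y.sum_coe_mul_ite_eq (fun c => z (.inr c))]
  have hA : IsBigraphic Sum.isLeft A := by
    constructor
    · rintro (c | c) i <;> simp only [A, Matrix.of_apply, Sum.elim_inl, Sum.elim_inr] <;>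
        split_ifs <;> simp
    · rintro (⟨c, _⟩ | ⟨c, _⟩) (⟨d, _⟩ | ⟨d, _⟩) i hc <;>
        simp only [A, Matrix.of_apply, Sum.elim_inl, Sum.elim_inr, Sum.isLeft_inl,
          Sum.isLeft_inr, reduceCtorEq] at hc ⊢ <;>
        split_ifs <;> simp_all
  have hX : ∀ i, (if x i ∈ X then x i else 0) = x i ∧
      (if x i + a i ∈ X then x i + a i else 0) = x i + a i := by
    intro i
    constructor
    · by_cases h0 : x i = 0 <;> simp [X, h0]
    · by_cases h0 : x i + a i = 0 <;> simp [X, h0]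
  have hY : ∀ i, (if y i ∈ Y then y i else 0) = y i ∧
      (if y i + a i ∈ Y then y i + a i else 0) =
        y i + a i - N * (if y i + a i = N then 1 else 0) := by
    intro i
    have h1 : y i ≠ N := by apply ne_of_lt; linarith [h.pos i, h.y_le i]
    have h2 : y i + a i ≠ 0 := by apply ne_of_gt; linarith [h.pos i, h.y_nonneg i]
    constructor
    · by_cases h0 : y i = 0
      · rw [h0]; simp
      · simp [Y, h0, h1]
    · by_cases h0 : y i + a i = N
      · rw [h0]; simp [Y]
      · simp [Y, h0, h2]
  refine hA.le_pow_of_solution ht ht3 (fun z hz => ?_)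
    (z := Sum.elim (fun c => (c : ℝ)) (fun c => (c : ℝ)))
    (u := fun i => if y i + a i = N then 1 else 0) (fun i => ?_)
    (q := fun l => Sum.elim (fun c : X => (if x hunit.choose + a hunit.choose = c then 1 else 0) -
      if x hunit.choose = c then 1 else 0) (fun _ => 0) l) ?_
  · have hzero := h.eq_zero_of_forall_sub_eq M.cast_nonneg N.cast_nonneg
      (f := fun c => if h : c ∈ X then z (.inl ⟨c, h⟩) else 0)
      (g := fun c => if h : c ∈ Y then z (.inr ⟨c, h⟩) else 0)
      (by simp [X]) (by simp [Y]) (by simp [Y]) (fun i => by linarith [hsum z i, hz i])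
    ext (⟨c, hc⟩ | ⟨c, hc⟩)
    · have hc' := Finset.mem_of_mem_erase hc
      simp only [Finset.mem_union, Finset.mem_image, Finset.mem_univ, true_and] at hc'
      rcases hc' with ⟨i, rfl⟩ | ⟨i, rfl⟩
      · simpa [hc] using (hzero i).1
      · simpa [hc] using (hzero i).2.1
    · have hc' := Finset.mem_of_mem_erase (Finset.mem_of_mem_erase hc)
      simp only [Finset.mem_union, Finset.mem_image, Finset.mem_univ, true_and] at hc'
      rcases hc' with ⟨i, rfl⟩ | ⟨i, rfl⟩
      · simpa [hc] using (hzero i).2.2.1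
      · simpa [hc] using (hzero i).2.2.2
  · rw [hsum]
    simp only [Sum.elim_inl, Sum.elim_inr, dite_eq_ite, hX, hY, Int.cast_ite, Int.cast_one,
      Int.cast_zero]
    ring
  · have h1 := hunit.choose_spec
    simp only [Fintype.sum_sum_type, Sum.elim_inl, Sum.elim_inr, Int.cast_sub, Int.cast_ite,
      Int.cast_one, Int.cast_zero, mul_sub, Finset.sum_sub_distrib, mul_zero,
      Finset.sum_const_zero, add_zero]
    rw [X.sum_coe_mul_ite_eq (fun c => (c : ℝ)), X.sum_coe_mul_ite_eq (fun c => (c : ℝ))]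
    simp only [dite_eq_ite, hX]
    linarith

/-- **Size of a squaring containing a unit square.**
If `max M N ≥ τ ^ k` (where `τ > 1` is the real root of `x³ = x² + 3`), then any
squaring of the rectangle `R = [0,M] × [0,N]` into `n` axis-parallel squares with
positive integer side lengths, at least one of which is a unit square, consists of at
least `k` tiles: `n ≥ k`. -/
theorem size_of_squaring_with_unit_square (τ : ℝ) (hτ1 : 1 < τ) (hτ : τ ^ 3 = τ ^ 2 + 3)
    (M N : ℕ) (hM : 0 < M) (hN : 0 < N) (k : ℕ)
    (hk : (max M N : ℝ) ≥ τ ^ k) (n : ℕ)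
    (x y : Fin n → ℝ) (a : Fin n → ℕ) (ha : ∀ i, 0 < a i)
    (hsub : ∀ i, sqTile (x i) (y i) (a i) ⊆
      Set.Icc (0 : ℝ) M ×ˢ Set.Icc (0 : ℝ) N)
    (hdisj : Pairwise fun i j =>
      Disjoint (interior (sqTile (x i) (y i) (a i)))
        (interior (sqTile (x j) (y j) (a j))))
    (hcover : (⋃ i, sqTile (x i) (y i) (a i)) =
      Set.Icc (0 : ℝ) M ×ˢ Set.Icc (0 : ℝ) N)
    (hunit : ∃ i, a i = 1) :
    n ≥ k := by
  have hsq : IsSquaring (M : ℝ) (N : ℝ) x y fun i => (a i : ℝ) := by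
    have hcorner : ∀ i, (0 ≤ x i ∧ x i + a i ≤ M) ∧ (0 ≤ y i ∧ y i + a i ≤ N) := by
      intro i
      have h0 : (0 : ℝ) ≤ a i := Nat.cast_nonneg _
      have h1 := hsub i (show (x i, y i) ∈ _ from ⟨⟨le_rfl, by simp⟩, ⟨le_rfl, by simp⟩⟩)
      have h2 := hsub i (show (x i + a i, y i + a i) ∈ _ from
        ⟨⟨by simp, le_rfl⟩, ⟨by simp, le_rfl⟩⟩)
      exact ⟨⟨h1.1.1, h2.1.2⟩, ⟨h1.2.1, h2.2.2⟩⟩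
    refine ⟨fun i => Nat.cast_pos.2 (ha i), fun i => (hcorner i).1.1, fun i => (hcorner i).1.2,
      fun i => (hcorner i).2.1, fun i => (hcorner i).2.2, ?_, ?_⟩
    · intro i j p q hp hp' hq hq'
      by_contra hij
      have hint := hdisj hij
      simp only [sqTile, interior_prod_eq, interior_Icc] at hint
      exact Set.disjoint_left.1 hint (show (p, q) ∈ _ from ⟨hp, hq⟩) ⟨hp', hq'⟩
    · intro p hp q hq
      have hpq : (p, q) ∈ ⋃ i, sqTile (x i) (y i) (a i) := by rw [hcover]; exact ⟨hp, hq⟩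
      obtain ⟨i, hi⟩ := Set.mem_iUnion.1 hpq
      exact ⟨i, hi.1, hi.2⟩
  have hunit' : ∃ i, (a i : ℝ) = 1 := hunit.imp fun i hi => by simp [hi]
  have hτ2 : τ ^ 2 + τ + 1 ≤ τ ^ 3 := by
    have : τ ≤ 2 := by
      by_contra! h2
      nlinarith [mul_pos (sub_pos.2 h2) (sub_pos.2 h2)]
    linarith
  have hle : τ ^ k ≤ τ ^ n := le_trans hk
    (max_le (hsq.swap.height_le_pow hτ1 hτ2 hunit') (hsq.height_le_pow hτ1 hτ2 hunit'))
  exact (pow_le_pow_iff_right₀ hτ1).1 hle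
end

section
/- Let k be a natural number, N = 2^k, and let p, q be integers with 0 ≤ p < N and 0 ≤ q < N. Suppose the region S obtained from the square [0,N] × [0,N] ⊆ ℝ² by removing the interior of the unit cell [p,p+1] × [q,q+1] is dissected into m axis-parallel squares with positive integer side lengths (tiles contained in S, with pairwise disjoint interiors, whose union is S). Then τ^(m+1) ≥ 2^k; in particular, m + 1 ≥ k·log_τ 2 ≈ 1.1134·k. -/
/-- The square `[0, 2^k] × [0, 2^k] ⊆ ℝ²` with the interior of the unit cell
`[p, p+1] × [q, q+1]` removed. -/
def puncturedSquare (k p q : ℕ) : Set (ℝ × ℝ) :=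
  (Set.Icc (0 : ℝ) (2 ^ k) ×ˢ Set.Icc (0 : ℝ) (2 ^ k)) \
    (Set.Ioo (p : ℝ) (p + 1) ×ˢ Set.Ioo (q : ℝ) (q + 1))

section PuncturedSquare

open Matrix MeasureTheory

theorem trace_pow_eq_sum_eigenvalues {n : Type*} [Fintype n] [DecidableEq n] {M : Matrix n n ℝ}
    (hM : M.IsHermitian) (k : ℕ) : (M ^ k).trace = ∑ i, hM.eigenvalues i ^ k := by
  conv_lhs => rw [hM.spectral_theorem, ← map_pow, Unitary.conjStarAlgAut_apply,
    Matrix.trace_mul_cycle, Unitary.coe_star_mul_self, one_mul, Matrix.diagonal_pow,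
    Matrix.trace_diagonal]
  simp

theorem conj_one_add_smul_eq_diagonal {n : Type*} [Fintype n] [DecidableEq n] {M : Matrix n n ℝ}
    (hM : M.IsHermitian) (c : ℝ) :
    star (hM.eigenvectorUnitary : Matrix n n ℝ) * (1 + c • M) * hM.eigenvectorUnitary =
      diagonal fun i => 1 + c * hM.eigenvalues i := by
  have h : Unitary.conjStarAlgAut ℝ _ (star hM.eigenvectorUnitary) (1 + c • M) =
      diagonal fun i => 1 + c * hM.eigenvalues i := by
    rw [map_add, map_one, map_smul, hM.conjStarAlgAut_star_eigenvectorUnitary]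
    ext i j
    by_cases hij : i = j <;> simp [hij]
  rwa [Unitary.conjStarAlgAut_star_apply] at h

theorem det_one_add_smul {n : Type*} [Fintype n] [DecidableEq n] {M : Matrix n n ℝ}
    (hM : M.IsHermitian) (c : ℝ) : (1 + c • M).det = ∏ i, (1 + c * hM.eigenvalues i) := by
  rw [← Matrix.det_diagonal, ← conj_one_add_smul_eq_diagonal, Matrix.det_mul_right_comm,
    Unitary.coe_star_mul_self, one_mul]

theorem one_add_mul_eigenvalues_pos {n : Type*} [Fintype n] [DecidableEq n] {M : Matrix n n ℝ}
    (hM : M.IsHermitian) (c : ℝ) (hp : (1 + c • M).PosDef) (i : n) :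
    0 < 1 + c * hM.eigenvalues i := by
  have h := hp.conjTranspose_mul_mul_same (B := (hM.eigenvectorUnitary : Matrix n n ℝ))
    (Function.LeftInverse.injective (g := (star (hM.eigenvectorUnitary : Matrix n n ℝ)).mulVec)
      fun v => by rw [mulVec_mulVec, Unitary.coe_star_mul_self, one_mulVec])
  rw [← Matrix.star_eq_conjTranspose, conj_one_add_smul_eq_diagonal,
    Matrix.posDef_diagonal_iff] at h
  exact h i

theorem sum_log_one_sub_le_sum_log_one_add {n : Type*} [Fintype n] (μ : n → ℝ)
    (hμ : ∀ i, |μ i| < 1) (htr : ∀ k : ℕ, 0 ≤ ∑ i, μ i ^ k) :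
    ∑ i, Real.log (1 - μ i) ≤ ∑ i, Real.log (1 + μ i) := by
  have h := hasSum_sum (s := Finset.univ) fun i _ =>
    Real.hasSum_log_sub_log_of_abs_lt_one (hμ i)
  have h0 := h.nonneg fun k => by
    rw [← Finset.mul_sum]
    exact mul_nonneg (by positivity) (htr _)
  rw [Finset.sum_sub_distrib] at h0
  linarith

theorem log_le_log_three_fourths_add (t : ℝ) (ht : 0 < t) :
    Real.log t ≤ Real.log (3 / 4) + 4 / 3 * t - 1 := by
  have h := Real.log_le_sub_one_of_pos (show 0 < 4 / 3 * t by positivity)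
  have h2 : Real.log t = Real.log (3 / 4) + Real.log (4 / 3 * t) := by
    rw [← Real.log_mul (by norm_num) (by positivity)]
    congr 1
    ring
  linarith

theorem matrix_pow_apply_nonneg {n : Type*} [Fintype n] [DecidableEq n] {M : Matrix n n ℝ}
    (h0 : ∀ i j, 0 ≤ M i j) (k : ℕ) (i j : n) : 0 ≤ (M ^ k) i j := by
  induction k generalizing i j with
  | zero => rw [pow_zero, Matrix.one_apply]; split_ifs <;> norm_num
  | succ k ih =>
    rw [pow_succ, Matrix.mul_apply]
    exact Finset.sum_nonneg fun l _ => mul_nonneg (ih _ _) (h0 _ _)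

theorem two_mul_log_det_one_sub_le {n : Type*} [Fintype n] [DecidableEq n] {M : Matrix n n ℝ}
    (hM : M.IsHermitian) (h0 : ∀ i j, 0 ≤ M i j) (hm : (1 - M).PosDef) (hp : (1 + M).PosDef) :
    2 * Real.log (1 - M).det ≤
      ∑ _i : n, (Real.log (3 / 4) + 1 / 3) - 4 / 3 * ∑ i, ∑ j, M i j ^ 2 := by
  have em : 1 - M = 1 + (-1 : ℝ) • M := by rw [neg_one_smul, sub_eq_add_neg]
  have hlt : ∀ i, 0 < 1 - hM.eigenvalues i := fun i => by
    have := one_add_mul_eigenvalues_pos hM (-1) (em ▸ hm) i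
    linarith
  have hgt : ∀ i, 0 < 1 + hM.eigenvalues i := fun i => by
    have := one_add_mul_eigenvalues_pos hM 1 (by rwa [one_smul]) i
    linarith
  have htr : ∀ k : ℕ, 0 ≤ ∑ i, hM.eigenvalues i ^ k := fun k => by
    rw [← trace_pow_eq_sum_eigenvalues]
    exact Finset.sum_nonneg fun i _ => matrix_pow_apply_nonneg h0 k i i
  have hdet : Real.log (1 - M).det = ∑ i, Real.log (1 - hM.eigenvalues i) := by
    rw [em, det_one_add_smul hM, Real.log_prod fun i _ => by linarith [hlt i]]
    simp [sub_eq_add_neg]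
  have hle := sum_log_one_sub_le_sum_log_one_add hM.eigenvalues
    (fun i => abs_lt.2 ⟨by linarith [hgt i], by linarith [hlt i]⟩) htr
  have hsq : ∑ i, ∑ j, M i j ^ 2 = ∑ i, hM.eigenvalues i ^ 2 := by
    rw [← trace_pow_eq_sum_eigenvalues, pow_two, Matrix.trace]
    refine Finset.sum_congr rfl fun i _ => ?_
    rw [Matrix.diag_apply, Matrix.mul_apply]
    refine Finset.sum_congr rfl fun j _ => ?_
    rw [← hM.apply j i, star_trivial, pow_two]
  calc 2 * Real.log (1 - M).det
      ≤ ∑ i, Real.log (1 - hM.eigenvalues i) + ∑ i, Real.log (1 + hM.eigenvalues i) := by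
        linarith
    _ = ∑ i, Real.log (1 - hM.eigenvalues i ^ 2) := by
        rw [← Finset.sum_add_distrib]
        refine Finset.sum_congr rfl fun i _ => ?_
        rw [← Real.log_mul (hlt i).ne' (hgt i).ne']
        congr 1
        ring
    _ ≤ ∑ i, ((Real.log (3 / 4) + 1 / 3) - 4 / 3 * hM.eigenvalues i ^ 2) := by
        refine Finset.sum_le_sum fun i _ => ?_
        have := log_le_log_three_fourths_add (1 - hM.eigenvalues i ^ 2)
          (by nlinarith [mul_pos (hlt i) (hgt i)])
        linarith
    _ = _ := by rw [Finset.sum_sub_distrib, hsq, Finset.mul_sum]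

theorem two_mul_log_det_diagonal_sub_le {n : Type*} [Fintype n] [DecidableEq n]
    (d : n → ℝ) (hd : ∀ i, 0 < d i) {A : Matrix n n ℝ}
    (hA : A.IsHermitian) (h0 : ∀ i j, 0 ≤ A i j) (hm : (diagonal d - A).PosDef)
    (hp : (diagonal d + A).PosDef) :
    2 * Real.log (diagonal d - A).det ≤
      ∑ i, (2 * Real.log (d i) + (Real.log (3 / 4) + 1 / 3)) -
        4 / 3 * ∑ i, ∑ j, A i j ^ 2 / (d i * d j) := by
  set r : n → ℝ := fun i => (√(d i))⁻¹ with hr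
  have hr0 : ∀ i, 0 < r i := fun i => inv_pos.2 (Real.sqrt_pos.2 (hd i))
  have hr2 : ∀ i, r i * r i * d i = 1 := fun i => by
    have := Real.mul_self_sqrt (hd i).le
    have h := (Real.sqrt_pos.2 (hd i)).ne'
    simp only [hr]
    field_simp
    rw [pow_two, this]
  set M : Matrix n n ℝ := diagonal r * A * diagonal r with hMdef
  have hMij : ∀ i j, M i j = r i * A i j * r j := fun i j => by
    rw [hMdef, Matrix.mul_diagonal, Matrix.diagonal_mul]
  have hone : diagonal r * diagonal d * diagonal r = (1 : Matrix n n ℝ) := by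
    rw [diagonal_mul_diagonal, diagonal_mul_diagonal, ← diagonal_one]
    congr 1
    funext i
    linarith [hr2 i]
  have hrt : (diagonal r)ᴴ = diagonal r := by
    rw [diagonal_conjTranspose, star_trivial]
  have hinj : Function.Injective (diagonal r).mulVec := by
    apply Matrix.mulVec_injective_of_isUnit
    rw [Matrix.isUnit_iff_isUnit_det, det_diagonal, isUnit_iff_ne_zero]
    exact Finset.prod_ne_zero_iff.2 fun i _ => (hr0 i).ne'
  have e1 : diagonal r * (diagonal d - A) * diagonal r = 1 - M := by
    rw [mul_sub, sub_mul, hone]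
  have e2 : diagonal r * (diagonal d + A) * diagonal r = 1 + M := by
    rw [mul_add, add_mul, hone]
  have hm' : (1 - M).PosDef := by
    have := hm.conjTranspose_mul_mul_same hinj
    rwa [hrt, e1] at this
  have hp' : (1 + M).PosDef := by
    have := hp.conjTranspose_mul_mul_same hinj
    rwa [hrt, e2] at this
  have hM : M.IsHermitian := by
    have := isHermitian_conjTranspose_mul_mul (diagonal r) hA
    rwa [hrt] at this
  have key := two_mul_log_det_one_sub_le hM
    (fun i j => by rw [hMij]; exact mul_nonneg (mul_nonneg (hr0 i).le (h0 i j)) (hr0 j).le) hm' hp'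
  have hdet : (diagonal d - A).det = (∏ i, d i) * (1 - M).det := by
    rw [← e1, det_mul, det_mul, det_diagonal]
    have : (∏ i, r i) * (∏ i, r i) * ∏ i, d i = 1 := by
      rw [← Finset.prod_mul_distrib, ← Finset.prod_mul_distrib]
      exact Finset.prod_eq_one fun i _ => hr2 i
    linear_combination (-(diagonal d - A).det) * this
  rw [hdet, Real.log_mul (Finset.prod_ne_zero_iff.2 fun i _ => (hd i).ne') hm'.det_pos.ne',
    Real.log_prod fun i _ => (hd i).ne', mul_add, Finset.mul_sum, Finset.sum_add_distrib]
  have hs : ∑ i, ∑ j, M i j ^ 2 = ∑ i, ∑ j, A i j ^ 2 / (d i * d j) := by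
    refine Finset.sum_congr rfl fun i _ => Finset.sum_congr rfl fun j _ => ?_
    rw [hMij, eq_div_iff (mul_pos (hd i) (hd j)).ne']
    linear_combination (A i j ^ 2) * (r j * r j * d j * hr2 i + hr2 j)
  rw [hs] at key
  linarith

theorem log_five_le : Real.log 5 ≤ (7 * Real.log 2 - 3 / 128) / 3 := by
  have h := Real.log_le_sub_one_of_pos (show (0 : ℝ) < 125 / 128 by norm_num)
  rw [show (125 / 128 : ℝ) = 5 ^ 3 / 2 ^ 7 by norm_num, Real.log_div (by norm_num) (by norm_num),
    Real.log_pow, Real.log_pow] at h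
  norm_num at h ⊢
  linarith

theorem log_seven_le : Real.log 7 ≤ (4 * Real.log 2 + Real.log 3 + 1 / 48) / 2 := by
  have h := Real.log_le_sub_one_of_pos (show (0 : ℝ) < 49 / 48 by norm_num)
  rw [show (49 / 48 : ℝ) = 7 ^ 2 / (2 ^ 4 * 3) by norm_num,
    Real.log_div (by norm_num) (by norm_num), Real.log_mul (by norm_num) (by norm_num),
    Real.log_pow, Real.log_pow] at h
  norm_num at h ⊢
  linarith

theorem log_three_lt : Real.log 3 < 1.09863 := by
  have h := Real.log_le_sub_one_of_pos (show (0 : ℝ) < 531441 / 524288 by norm_num)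
  rw [show (531441 / 524288 : ℝ) = 3 ^ 12 / 2 ^ 19 by norm_num,
    Real.log_div (by norm_num) (by norm_num), Real.log_pow, Real.log_pow] at h
  have := Real.log_two_lt_d9
  norm_num at h ⊢
  linarith

theorem lt_log_three : 1.0983 < Real.log 3 := by
  have h := Real.log_le_sub_one_of_pos (show (0 : ℝ) < 256 / 243 by norm_num)
  rw [show (256 / 243 : ℝ) = 2 ^ 8 / 3 ^ 5 by norm_num,
    Real.log_div (by norm_num) (by norm_num), Real.log_pow, Real.log_pow] at h
  have := Real.log_two_gt_d9
  norm_num at h ⊢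
  linarith

/-- The contribution of a half-edge at a vertex of degree `d` to the bound on the determinant. -/
noncomputable def halfEdgeWeight (d : ℕ) : ℝ :=
  (2 * Real.log d + (Real.log (3 / 4) + 1 / 3)) / d

theorem log_three_div_four : Real.log (3 / 4) = Real.log 3 - 2 * Real.log 2 := by
  rw [Real.log_div (by norm_num) (by norm_num), show (4 : ℝ) = 2 ^ 2 by norm_num, Real.log_pow]
  norm_num

theorem log_twelve : Real.log 12 = 2 * Real.log 2 + Real.log 3 := by
  rw [show (12 : ℝ) = 2 ^ 2 * 3 by norm_num, Real.log_mul (by norm_num) (by norm_num),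
    Real.log_pow]
  norm_num

theorem halfEdgeWeight_le_of_nine_le {d : ℕ} (hd : 9 ≤ d) : halfEdgeWeight d ≤ 0.49345 := by
  have hd' : (9 : ℝ) ≤ d := by exact_mod_cast hd
  have h := Real.log_le_sub_one_of_pos (show (0 : ℝ) < d / 9 by positivity)
  rw [Real.log_div (by positivity) (by norm_num), show (9 : ℝ) = 3 ^ 2 by norm_num,
    Real.log_pow] at h
  have h3 := log_three_lt
  have h2 := Real.log_two_gt_d9
  rw [halfEdgeWeight, div_le_iff₀ (by positivity), log_three_div_four]
  norm_num at h h2 h3 ⊢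
  linarith

theorem halfEdgeWeight_values :
    halfEdgeWeight 1 ≤ 0.05 ∧ halfEdgeWeight 2 ≤ 0.7165 ∧ halfEdgeWeight 3 ≤ 0.7477 ∧
    halfEdgeWeight 4 = Real.log 12 / 4 + 1 / 12 ∧ halfEdgeWeight 5 ≤ 0.654 ∧
    halfEdgeWeight 6 ≤ 0.606 ∧ halfEdgeWeight 7 ≤ 0.563 ∧ halfEdgeWeight 8 ≤ 0.527 := by
  have h3 := log_three_lt
  have h2 := Real.log_two_gt_d9
  have h2' := Real.log_two_lt_d9
  have h5 := log_five_le
  have h7 := log_seven_le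
  have e4 : Real.log 4 = 2 * Real.log 2 := by
    rw [show (4 : ℝ) = 2 ^ 2 by norm_num, Real.log_pow]; norm_num
  have e6 : Real.log 6 = Real.log 2 + Real.log 3 := by
    rw [← Real.log_mul (by norm_num) (by norm_num)]; norm_num
  have e8 : Real.log 8 = 3 * Real.log 2 := by
    rw [show (8 : ℝ) = 2 ^ 3 by norm_num, Real.log_pow]; norm_num
  simp only [halfEdgeWeight, log_three_div_four, log_twelve]
  norm_num [e4, e6, e8] at h2 h2' h3 ⊢
  refine ⟨?_, ?_, ?_, ?_, ?_, ?_, ?_, ?_⟩ <;> linarith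

theorem halfEdgeWeight_le {d : ℕ} (hd : 0 < d) : halfEdgeWeight d ≤ 0.7477 := by
  obtain ⟨h1, h2, h3, h4, h5, h6, h7, h8⟩ := halfEdgeWeight_values
  rcases lt_or_ge d 9 with h | h
  · have hl3 := log_three_lt
    have hl2 := Real.log_two_lt_d9
    rw [log_twelve] at h4
    interval_cases d <;> linarith
  · linarith [halfEdgeWeight_le_of_nine_le h]

theorem log_twelve_gt : 2.4845 < Real.log 12 := by
  have h3 := lt_log_three
  have h2 := Real.log_two_gt_d9
  rw [log_twelve]
  linarith

theorem halfEdgeWeight_add_le {a b : ℕ} (ha : 0 < a) (hb : 0 < b) :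
    halfEdgeWeight a + halfEdgeWeight b - 8 / 3 * ((a : ℝ)⁻¹ * (b : ℝ)⁻¹) ≤
      Real.log 12 / 2 := by
  have hK := log_twelve_gt
  have hpos : 0 ≤ (a : ℝ)⁻¹ * (b : ℝ)⁻¹ := by positivity
  rcases lt_or_ge b 9 with hb9 | hb9
  · rcases lt_or_ge a 9 with ha9 | ha9
    · obtain ⟨h1, h2, h3, h4, h5, h6, h7, h8⟩ := halfEdgeWeight_values
      have hK' : Real.log 12 < 2.485 := by
        have h3 := log_three_lt
        have h2 := Real.log_two_lt_d9
        rw [log_twelve]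
        linarith
      clear hpos
      interval_cases a <;> interval_cases b <;> norm_num at * <;> linarith
    · linarith [halfEdgeWeight_le_of_nine_le ha9, halfEdgeWeight_le hb]
  · linarith [halfEdgeWeight_le_of_nine_le hb9, halfEdgeWeight_le ha]

/-- The incidence matrix (over `R`) of the graph with edges `E` and non-root vertices `V`, in which
`e` joins `t e` to `s e` (`none` being the root), with entry `σ` at the second endpoint. -/
def incidence {V E : Type*} (R : Type*) [CommRing R] [DecidableEq V] (t : E → V)
    (s : E → Option V) (σ : R) : Matrix V E R :=
  fun v e => (if t e = v then 1 else 0) + σ * (if s e = some v then 1 else 0)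

/-- The degree of a non-root vertex. -/
def rootedDegree {V E : Type*} [Fintype E] [DecidableEq V] (t : E → V) (s : E → Option V)
    (v : V) : ℕ :=
  ∑ e, ((if t e = v then 1 else 0) + (if s e = some v then 1 else 0))

/-- The number of edges between two non-root vertices. -/
def rootedAdj {V E : Type*} [Fintype E] [DecidableEq V] (t : E → V) (s : E → Option V)
    (u v : V) : ℕ :=
  ∑ e, ((if t e = u then 1 else 0) * (if s e = some v then 1 else 0) +
    (if s e = some u then 1 else 0) * (if t e = v then 1 else 0))

section RootedGraph

variable {V E : Type*} [Fintype E] [DecidableEq V] {t : E → V} {s : E → Option V}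

theorem sum_ite_some_mul [Fintype V] (o : Option V) (g : V → ℝ) :
    ∑ v, (if o = some v then 1 else 0) * g v = o.elim 0 g := by
  cases o <;> simp

theorem incidence_mul_transpose (hloop : ∀ e, s e ≠ some (t e)) {σ : ℝ} (hσ : σ * σ = 1) :
    incidence ℝ t s σ * (incidence ℝ t s σ)ᵀ =
      diagonal (fun v => (rootedDegree t s v : ℝ)) +
        σ • Matrix.of (fun u v => (rootedAdj t s u v : ℝ)) := by
  ext u v
  rw [mul_apply, Matrix.add_apply, Matrix.smul_apply, smul_eq_mul, diagonal_apply]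
  have hterm : ∀ e, incidence ℝ t s σ u e * (incidence ℝ t s σ)ᵀ e v =
      (if u = v then ((if t e = u then 1 else 0) + (if s e = some u then 1 else 0) : ℝ) else 0) +
      σ * ((if t e = u then 1 else 0) * (if s e = some v then 1 else 0) +
        (if s e = some u then 1 else 0) * (if t e = v then 1 else 0)) := by
    intro e
    simp only [incidence, transpose_apply]
    have hl := hloop e
    have hT : ((if t e = u then 1 else 0) * (if t e = v then 1 else 0) : ℝ) =
        if u = v then (if t e = u then 1 else 0) else 0 := by
      split_ifs <;> simp_all
    have hS : ((if s e = some u then 1 else 0) * (if s e = some v then 1 else 0) : ℝ) =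
        if u = v then (if s e = some u then 1 else 0) else 0 := by
      split_ifs <;> simp_all
    have hTS : (if u = v then ((if t e = u then 1 else 0) + (if s e = some u then 1 else 0) : ℝ)
        else 0) = (if u = v then (if t e = u then 1 else 0) else 0) +
          (if u = v then (if s e = some u then 1 else 0) else 0) := by
      split_ifs <;> simp
    rw [hTS, ← hT, ← hS]
    linear_combination
      ((if s e = some u then 1 else 0) * (if s e = some v then 1 else 0) : ℝ) * hσ
  rw [Finset.sum_congr rfl fun e _ => hterm e, Finset.sum_add_distrib, ← Finset.mul_sum]
  congr 1
  · by_cases h : u = v <;> simp [h, rootedDegree]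
  · simp [rootedAdj]

variable [Fintype V]

theorem posDef_incidence_mul_transpose (r : V → ℝ)
    (hr : ∀ v, ∃ e, t e = v ∧ ∀ u, s e = some u → r u < r v) (σ : ℝ) :
    (incidence ℝ t s σ * (incidence ℝ t s σ)ᵀ).PosDef := by
  rw [← conjTranspose_eq_transpose_of_trivial]
  refine PosDef.mul_conjTranspose_self _ ?_
  rw [← coe_vecMulLinear, ← LinearMap.ker_eq_bot, LinearMap.ker_eq_bot']
  intro z hz
  have he : ∀ e, z (t e) + σ * (s e).elim 0 z = 0 := by
    intro e
    have := congrFun hz e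
    simp only [vecMulLinear_apply, vecMul, dotProduct, incidence, Pi.zero_apply] at this
    refine Eq.trans ?_ this
    rw [← sum_ite_some_mul, Finset.mul_sum]
    simp only [mul_add, Finset.sum_add_distrib]
    congr 1
    · simp
    · exact Finset.sum_congr rfl fun v _ => by ring
  by_contra hne
  obtain ⟨w, hw⟩ := Function.ne_iff.1 hne
  obtain ⟨v, hv, hmin⟩ := Finset.exists_min_image (Finset.univ.filter fun v => z v ≠ 0) r
    ⟨w, by simpa using hw⟩
  obtain ⟨e, rfl, hlt⟩ := hr v
  refine (Finset.mem_filter.1 hv).2 ?_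
  have h := he e
  cases hs : s e with
  | none => simpa [hs] using h
  | some u =>
    have hu : z u = 0 := by
      by_contra hu
      exact absurd (hmin u (by simpa using hu)) (not_le.2 (hlt u hs))
    simpa [hs, hu] using h

theorem two_mul_log_det_laplacian_le (hloop : ∀ e, s e ≠ some (t e)) (r : V → ℝ)
    (hr : ∀ v, ∃ e, t e = v ∧ ∀ u, s e = some u → r u < r v) :
    2 * Real.log (incidence ℝ t s (-1) * (incidence ℝ t s (-1))ᵀ).det ≤
      Fintype.card E * (Real.log 12 / 2) := by
  set d : V → ℕ := rootedDegree t s with hd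
  set A : Matrix V V ℝ := Matrix.of fun u v => (rootedAdj t s u v : ℝ) with hA
  have em := incidence_mul_transpose (σ := -1) hloop (by norm_num)
  have ep := incidence_mul_transpose (σ := 1) hloop (by norm_num)
  rw [neg_one_smul, ← sub_eq_add_neg] at em
  rw [one_smul] at ep
  have hm := posDef_incidence_mul_transpose r hr (-1)
  have hp := posDef_incidence_mul_transpose r hr 1
  rw [em] at hm ⊢
  rw [ep] at hp
  have hd_t : ∀ e, 0 < d (t e) := fun e => by
    refine Finset.sum_pos' (fun _ _ => Nat.zero_le _) ⟨e, Finset.mem_univ _, ?_⟩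
    simp
  have hd_s : ∀ e u, s e = some u → 0 < d u := fun e u h => by
    refine Finset.sum_pos' (fun _ _ => Nat.zero_le _) ⟨e, Finset.mem_univ _, ?_⟩
    simp [h]
  have hd0 : ∀ v, 0 < d v := fun v => by
    obtain ⟨e, rfl, -⟩ := hr v
    exact hd_t e
  have hAsymm : A.IsHermitian := by
    ext u v
    simp only [conjTranspose_apply, star_trivial, hA, of_apply, rootedAdj]
    congr 1
    exact Finset.sum_congr rfl fun e _ => by ring
  have key := two_mul_log_det_diagonal_sub_le (fun v => (d v : ℝ))
    (fun v => by exact_mod_cast hd0 v) hAsymm (fun u v => Nat.cast_nonneg _) hm hp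
  have h1 : ∑ v, (2 * Real.log (d v) + (Real.log (3 / 4) + 1 / 3)) =
      ∑ e, (halfEdgeWeight (d (t e)) + (s e).elim 0 fun v => halfEdgeWeight (d v)) := by
    have : ∀ v, 2 * Real.log (d v) + (Real.log (3 / 4) + 1 / 3) =
        ∑ e, ((if t e = v then 1 else 0) * halfEdgeWeight (d v) +
          (if s e = some v then 1 else 0) * halfEdgeWeight (d v)) := fun v => by
      have hv : (d v : ℝ) ≠ 0 := by exact_mod_cast (hd0 v).ne'
      have hdv : (d v : ℝ) =
          ∑ e, ((if t e = v then 1 else 0) + (if s e = some v then 1 else 0)) := by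
        simp [hd, rootedDegree]
      simp only [← add_mul]
      rw [← Finset.sum_mul, ← hdv, halfEdgeWeight, mul_div_cancel₀ _ hv]
    rw [Finset.sum_congr rfl fun v _ => this v, Finset.sum_comm]
    refine Finset.sum_congr rfl fun e _ => ?_
    rw [Finset.sum_add_distrib, sum_ite_some_mul]
    simp
  have h2 : ∑ e, 2 * ((d (t e) : ℝ)⁻¹ * (s e).elim 0 fun v => (d v : ℝ)⁻¹) ≤
      ∑ u, ∑ v, A u v ^ 2 / (d u * d v) := by
    calc ∑ e, 2 * ((d (t e) : ℝ)⁻¹ * (s e).elim 0 fun v => (d v : ℝ)⁻¹)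
        = ∑ u, ∑ v, A u v * ((d u : ℝ)⁻¹ * (d v : ℝ)⁻¹) := by
          have hA' : ∀ u v, A u v * ((d u : ℝ)⁻¹ * (d v : ℝ)⁻¹) = ∑ e,
              (((if t e = u then 1 else 0) * (d u : ℝ)⁻¹) *
                ((if s e = some v then 1 else 0) * (d v : ℝ)⁻¹) +
              ((if s e = some u then 1 else 0) * (d u : ℝ)⁻¹) *
                ((if t e = v then 1 else 0) * (d v : ℝ)⁻¹)) := fun u v => by
            simp only [hA, of_apply, rootedAdj, Nat.cast_sum, Finset.sum_mul]
            refine Finset.sum_congr rfl fun e _ => ?_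
            push_cast
            ring
          simp only [hA']
          rw [Finset.sum_congr rfl fun u _ => Finset.sum_comm, Finset.sum_comm]
          refine Finset.sum_congr rfl fun e _ => ?_
          simp only [Finset.sum_add_distrib, ← Finset.mul_sum, ← Finset.sum_mul,
            sum_ite_some_mul]
          simp
          ring
      _ ≤ _ := by
          refine Finset.sum_le_sum fun u _ => Finset.sum_le_sum fun v _ => ?_
          rw [div_eq_mul_inv, mul_inv]
          refine mul_le_mul_of_nonneg_right ?_ (by positivity)
          have : rootedAdj t s u v ≤ rootedAdj t s u v ^ 2 := Nat.le_self_pow two_ne_zero _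
          change (rootedAdj t s u v : ℝ) ≤ (rootedAdj t s u v : ℝ) ^ 2
          exact_mod_cast this
  have h3 : ∀ e, (halfEdgeWeight (d (t e)) + (s e).elim 0 fun v => halfEdgeWeight (d v)) -
      4 / 3 * (2 * ((d (t e) : ℝ)⁻¹ * (s e).elim 0 fun v => (d v : ℝ)⁻¹)) ≤
      Real.log 12 / 2 := fun e => by
    cases hs : s e with
    | none =>
      have := halfEdgeWeight_le (hd_t e)
      have := log_twelve_gt
      simp only [Option.elim_none, mul_zero]
      linarith
    | some u =>
      have := halfEdgeWeight_add_le (hd_t e) (hd_s e u hs)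
      simp only [Option.elim_some]
      linarith
  have h4 := Finset.sum_le_sum fun e (_ : e ∈ Finset.univ) => h3 e
  rw [Finset.sum_sub_distrib, ← Finset.mul_sum, ← h1, Finset.sum_const, Finset.card_univ,
    nsmul_eq_mul] at h4
  linarith

theorem le_det_laplacian (r : V → ℝ)
    (hr : ∀ v, ∃ e, t e = v ∧ ∀ u, s e = some u → r u < r v) {N : ℝ} (hN : 0 < N) (w : V)
    (z : V → ℝ)
    (hz : (incidence ℝ t s (-1) * (incidence ℝ t s (-1))ᵀ) *ᵥ z = Pi.single w N)
    (e : E) (he : z (t e) - (s e).elim 0 z = 1) :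
    N ≤ (incidence ℝ t s (-1) * (incidence ℝ t s (-1))ᵀ).det := by
  set C : Matrix V E ℤ := incidence ℤ t s (-1) with hC
  have hmap : incidence ℝ t s (-1) = C.map (Int.castRingHom ℝ) := by
    ext v e
    rw [hC, map_apply]
    simp only [incidence]
    split_ifs <;> simp
  set L : Matrix V V ℤ := C * Cᵀ with hL
  have hLR : incidence ℝ t s (-1) * (incidence ℝ t s (-1))ᵀ = L.map (Int.castRingHom ℝ) := by
    rw [hL, Matrix.map_mul, hmap, transpose_map]
  have hpos := (posDef_incidence_mul_transpose (s := s) r hr (-1)).det_pos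
  rw [hLR] at hz hpos ⊢
  have hdet : (L.map (Int.castRingHom ℝ)).det = (L.det : ℝ) := by
    simpa using ((Int.castRingHom ℝ).map_det L).symm
  have hadj : (L.map (Int.castRingHom ℝ)).adjugate = L.adjugate.map (Int.castRingHom ℝ) := by
    simpa using ((Int.castRingHom ℝ).map_adjugate L).symm
  have hcol : ∀ v, (L.det : ℝ) * z v = N * (L.adjugate v w : ℝ) := by
    intro v
    have h := congrFun (congrArg (fun x => (L.map (Int.castRingHom ℝ)).adjugate *ᵥ x) hz) v
    simp only [mulVec_mulVec, adjugate_mul, smul_mulVec, one_mulVec, hdet] at h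
    rw [hadj] at h
    simpa [mul_comm] using h
  have h_int : ∃ j : ℤ, (L.det : ℝ) = N * j := by
    refine ⟨L.adjugate (t e) w - (s e).elim 0 fun v => L.adjugate v w, ?_⟩
    have ht := hcol (t e)
    cases hs : s e with
    | none =>
      simp only [hs, Option.elim_none, sub_zero] at he ⊢
      rw [← ht, he, mul_one]
    | some u =>
      simp only [hs, Option.elim_some] at he ⊢
      rw [Int.cast_sub]
      linear_combination ht - hcol u - (L.det : ℝ) * he
  obtain ⟨j, hj⟩ := h_int
  rw [hdet] at hpos ⊢
  rw [hj] at hpos ⊢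
  have : (0 : ℝ) < j := pos_of_mul_pos_right hpos hN.le
  have hj1 : (1 : ℝ) ≤ j := by exact_mod_cast this
  nlinarith

end RootedGraph

section Slices

variable {E : Type*} [Fintype E] {X Y A : E → ℝ} {N : ℝ}

theorem sum_slice_eq (hA : ∀ i, 0 < A i) (hN : 0 < N)
    (hdisj : ∀ i j, i ≠ j → ∀ a b, a ∈ Set.Ioo (X i) (X i + A i) → b ∈ Set.Ioo (Y i) (Y i + A i) →
      a ∈ Set.Ioo (X j) (X j + A j) → b ∉ Set.Ioo (Y j) (Y j + A j))
    (hcover : ∀ a b, (a ∈ Set.Icc 0 N ∧ b ∈ Set.Icc 0 N) ↔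
      ∃ i, a ∈ Set.Icc (X i) (X i + A i) ∧ b ∈ Set.Icc (Y i) (Y i + A i))
    {h : ℝ} (h0 : 0 ≤ h) (hhN : h ≤ N) (hY : ∀ i, Y i ≠ h) (hYA : ∀ i, Y i + A i ≠ h) :
    ∑ i, (if Y i < h ∧ h < Y i + A i then A i else 0) = N := by
  classical
  rw [← Finset.sum_filter]
  set I := Finset.univ.filter fun i => Y i < h ∧ h < Y i + A i with hI
  have hmem : ∀ i, i ∈ I ↔ Y i < h ∧ h < Y i + A i := fun i => by simp [hI]
  have hvol : ENNReal.ofReal (∑ i ∈ I, A i) = ∑ i ∈ I, ENNReal.ofReal (A i) :=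
    ENNReal.ofReal_sum_of_nonneg fun i _ => (hA i).le
  apply le_antisymm
  · rw [← ENNReal.ofReal_le_ofReal_iff hN.le, hvol]
    calc ∑ i ∈ I, ENNReal.ofReal (A i)
        = ∑ i ∈ I, volume (Set.Ioo (X i) (X i + A i)) := by simp
      _ = volume (⋃ i ∈ I, Set.Ioo (X i) (X i + A i)) := by
          rw [measure_biUnion_finset _ fun _ _ => measurableSet_Ioo]
          intro i hi j hj hij
          exact Set.disjoint_left.2 fun a hai haj =>
            hdisj i j hij a h hai ((hmem i).1 hi) haj ((hmem j).1 hj)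
      _ ≤ volume (Set.Icc 0 N) := by
          refine measure_mono (Set.iUnion₂_subset fun i hi a ha => ?_)
          have hi' := (hmem i).1 hi
          exact ((hcover a h).2 ⟨i, Set.Ioo_subset_Icc_self ha, hi'.1.le, hi'.2.le⟩).1
      _ = ENNReal.ofReal N := by simp
  · rw [← ENNReal.ofReal_le_ofReal_iff (Finset.sum_nonneg fun i _ => (hA i).le), hvol]
    calc ENNReal.ofReal N = volume (Set.Icc 0 N) := by simp
      _ ≤ volume (⋃ i ∈ I, Set.Icc (X i) (X i + A i)) := by
          refine measure_mono fun a ha => ?_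
          obtain ⟨i, hai, hbi⟩ := (hcover a h).1 ⟨ha, h0, hhN⟩
          have hi : i ∈ I :=
            (hmem i).2 ⟨lt_of_le_of_ne hbi.1 (hY i), lt_of_le_of_ne hbi.2 (hYA i).symm⟩
          exact Set.mem_biUnion (x := i) hi hai
      _ ≤ ∑ i ∈ I, volume (Set.Icc (X i) (X i + A i)) := measure_biUnion_finset_le _ _
      _ = ∑ i ∈ I, ENNReal.ofReal (A i) := by simp

theorem exists_gap (S : Set ℝ) (hS : S.Finite) (v : ℝ) :
    ∃ ε > 0, ∀ w ∈ S, w ≠ v → w ≤ v - ε ∨ v + ε ≤ w := by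
  have ho : IsOpen (S \ {v})ᶜ := (hS.subset Set.sdiff_subset).isClosed.isOpen_compl
  obtain ⟨ε, hε, hb⟩ := Metric.isOpen_iff.1 ho v (by simp)
  refine ⟨ε, hε, fun w hw hwv => ?_⟩
  by_contra! hcon
  refine hb (a := w) ?_ ⟨hw, hwv⟩
  rw [Metric.mem_ball, Real.dist_eq, abs_lt]
  constructor <;> linarith [hcon.1, hcon.2]

/-- Kirchhoff's law: the tiles hanging from a horizontal line and the tiles standing on it have
the same total width, except on the upper boundary. -/
theorem sum_top_sub_sum_bottom (hA : ∀ i, 0 < A i) (hN : 0 < N)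
    (hdisj : ∀ i j, i ≠ j → ∀ a b, a ∈ Set.Ioo (X i) (X i + A i) → b ∈ Set.Ioo (Y i) (Y i + A i) →
      a ∈ Set.Ioo (X j) (X j + A j) → b ∉ Set.Ioo (Y j) (Y j + A j))
    (hcover : ∀ a b, (a ∈ Set.Icc 0 N ∧ b ∈ Set.Icc 0 N) ↔
      ∃ i, a ∈ Set.Icc (X i) (X i + A i) ∧ b ∈ Set.Icc (Y i) (Y i + A i))
    {v : ℝ} (h0 : 0 < v) (hvN : v ≤ N) :
    ∑ i, (if Y i + A i = v then A i else 0) - ∑ i, (if Y i = v then A i else 0) =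
      if v = N then N else 0 := by
  have htop : ∀ i, Y i + A i ≤ N := fun i =>
    ((hcover (X i) (Y i + A i)).2 ⟨i, ⟨le_rfl, by linarith [hA i]⟩, by linarith [hA i], le_rfl⟩).2.2
  obtain ⟨ε, hε, hgap⟩ := exists_gap ({0, N} ∪ Set.range Y ∪ Set.range fun i => Y i + A i)
    ((Set.toFinite _).union (Set.finite_range _)) v
  have hgY : ∀ i, Y i ≠ v → Y i ≤ v - ε ∨ v + ε ≤ Y i := fun i => hgap _ (by simp)
  have hgT : ∀ i, Y i + A i ≠ v → Y i + A i ≤ v - ε ∨ v + ε ≤ Y i + A i :=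
    fun i => hgap _ (by simp)
  have hε0 : ε ≤ v := by
    rcases hgap 0 (by simp) h0.ne with h | h <;> linarith
  have hY_ne : ∀ δ : ℝ, 0 < |δ| → |δ| < ε → ∀ i, Y i ≠ v + δ := fun δ h1 h2 i hi => by
    have := abs_lt.1 h2
    rcases eq_or_ne (Y i) v with h | h
    · rw [h] at hi
      exact (abs_pos.1 h1) (by linarith)
    · rcases hgY i h with h | h <;> linarith
  have hT_ne : ∀ δ : ℝ, 0 < |δ| → |δ| < ε → ∀ i, Y i + A i ≠ v + δ := fun δ h1 h2 i hi => by
    have := abs_lt.1 h2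
    rcases eq_or_ne (Y i + A i) v with h | h
    · rw [h] at hi
      exact (abs_pos.1 h1) (by linarith)
    · rcases hgT i h with h | h <;> linarith
  have hd1 : 0 < |-(ε / 2)| := by rw [abs_neg]; positivity
  have hd2 : |-(ε / 2)| < ε := by rw [abs_neg, abs_of_pos] <;> linarith
  have hd3 : 0 < |ε / 2| := by positivity
  have hd4 : |ε / 2| < ε := by rw [abs_of_pos] <;> linarith
  have hbelow := sum_slice_eq hA hN hdisj hcover (h := v + -(ε / 2)) (by linarith) (by linarith)
    (hY_ne _ hd1 hd2) (hT_ne _ hd1 hd2)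
  have habove : ∑ i, (if Y i < v + ε / 2 ∧ v + ε / 2 < Y i + A i then A i else 0) =
      if v = N then 0 else N := by
    split_ifs with hv
    · refine Finset.sum_eq_zero fun i _ => if_neg fun h => ?_
      linarith [htop i, h.2]
    · refine sum_slice_eq hA hN hdisj hcover (by linarith) ?_ (hY_ne _ hd3 hd4) (hT_ne _ hd3 hd4)
      rcases hgap N (by simp) (Ne.symm hv) with h | h <;> linarith
  have hterm : ∀ i, (if Y i + A i = v then A i else 0) - (if Y i = v then A i else 0) =
      (if Y i < v + -(ε / 2) ∧ v + -(ε / 2) < Y i + A i then A i else 0) -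
        (if Y i < v + ε / 2 ∧ v + ε / 2 < Y i + A i then A i else 0) := fun i => by
    have := hA i
    have hY := hgY i
    have hT := hgT i
    by_cases h1 : Y i = v
    · have h2 : Y i + A i ≠ v := by linarith
      rcases hT h2 with h3 | h3
      · linarith
      · rw [if_neg h2, if_pos h1, if_neg (by rintro ⟨h, -⟩; linarith),
          if_pos ⟨by linarith, by linarith⟩]
    · by_cases h2 : Y i + A i = v
      · rcases hY h1 with h3 | h3
        · rw [if_neg h1, if_pos h2, if_pos ⟨by linarith, by linarith⟩,
            if_neg (by rintro ⟨-, h⟩; linarith)]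
        · linarith
      · rw [if_neg h1, if_neg h2]
        have : (Y i < v + -(ε / 2) ∧ v + -(ε / 2) < Y i + A i) ↔
            (Y i < v + ε / 2 ∧ v + ε / 2 < Y i + A i) := by
          rcases hY h1 with h3 | h3 <;> rcases hT h2 with h4 | h4 <;>
            constructor <;> rintro ⟨h5, h6⟩ <;> constructor <;> linarith
        simp only [this, sub_self]
  rw [← Finset.sum_sub_distrib, Finset.sum_congr rfl fun i _ => hterm i, Finset.sum_sub_distrib,
    hbelow, habove]
  split_ifs <;> ring

end Slices

section Dissection

variable {E : Type*} [Fintype E] {X Y A : E → ℝ} {N : ℝ}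

/-- If a square of side `N` is dissected into squares, one of which has side `1`, then
`N ^ 4 ≤ 12 ^ n`, where `n` is the number of tiles. -/
theorem four_mul_log_side_le (hA : ∀ i, 0 < A i) (hN : 0 < N)
    (hdisj : ∀ i j, i ≠ j → ∀ a b, a ∈ Set.Ioo (X i) (X i + A i) → b ∈ Set.Ioo (Y i) (Y i + A i) →
      a ∈ Set.Ioo (X j) (X j + A j) → b ∉ Set.Ioo (Y j) (Y j + A j))
    (hcover : ∀ a b, (a ∈ Set.Icc 0 N ∧ b ∈ Set.Icc 0 N) ↔
      ∃ i, a ∈ Set.Icc (X i) (X i + A i) ∧ b ∈ Set.Icc (Y i) (Y i + A i))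
    (i₀ : E) (hi₀ : A i₀ = 1) :
    4 * Real.log N ≤ Fintype.card E * Real.log 12 := by
  classical
  have hbal := fun v => sum_top_sub_sum_bottom hA hN hdisj hcover (v := v)
  have htop : ∀ i, Y i + A i ≤ N := fun i =>
    ((hcover (X i) (Y i + A i)).2 ⟨i, ⟨le_rfl, by linarith [hA i]⟩, by linarith [hA i], le_rfl⟩).2.2
  have hbot : ∀ i, 0 ≤ Y i := fun i =>
    ((hcover (X i) (Y i)).2 ⟨i, ⟨le_rfl, by linarith [hA i]⟩, le_rfl, by linarith [hA i]⟩).2.1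
  set S : Finset ℝ := Finset.univ.image fun i => Y i + A i with hS
  have hmemS : ∀ v, v ∈ S ↔ ∃ i, Y i + A i = v := fun v => by simp [hS]
  have hexists : ∀ v, 0 < v → v ≤ N → (v = N ∨ ∃ i, Y i = v) → v ∈ S := by
    intro v h0 hvN hv
    rw [hmemS]
    by_contra! hcon
    have h := hbal v h0 hvN
    rw [Finset.sum_eq_zero fun i _ => if_neg (hcon i)] at h
    have hnn : ∀ i ∈ Finset.univ, 0 ≤ (if Y i = v then A i else 0) := fun i _ => by
      split_ifs
      exacts [(hA i).le, le_rfl]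
    have hs := Finset.sum_nonneg hnn
    rcases hv with rfl | ⟨i, hi⟩
    · rw [if_pos rfl] at h
      linarith
    · have h1 := Finset.single_le_sum hnn (Finset.mem_univ i)
      rw [if_pos hi] at h1
      have := hA i
      split_ifs at h <;> linarith
  let t : E → S := fun i => ⟨Y i + A i, (hmemS _).2 ⟨i, rfl⟩⟩
  let s : E → Option S := fun i => if h : Y i ∈ S then some ⟨Y i, h⟩ else none
  have hs : ∀ i (u : S), s i = some u ↔ Y i = u := by
    intro i u
    by_cases h : Y i ∈ S
    · simp [s, h, Subtype.ext_iff]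
    · have : Y i ≠ u := fun hu => h (hu ▸ u.2)
      simp [s, h, this]
  have hselim : ∀ i, (s i).elim 0 (fun v : S => (v : ℝ)) = Y i := by
    intro i
    by_cases h : Y i ∈ S
    · simp [s, h]
    · have : Y i = 0 := by
        by_contra hne
        exact h (hexists _ (lt_of_le_of_ne (hbot i) (Ne.symm hne)) (by linarith [htop i, hA i])
          (Or.inr ⟨i, rfl⟩))
      simp only [s, dif_neg h, Option.elim_none]
      exact this.symm
  have hloop : ∀ i, s i ≠ some (t i) := by
    intro i h
    have := (hs i _).1 h
    simp only [t] at this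
    linarith [hA i]
  have hr : ∀ v : S, ∃ i, t i = v ∧ ∀ u : S, s i = some u → (u : ℝ) < v := by
    rintro ⟨v, hv⟩
    obtain ⟨i, hi⟩ := (hmemS v).1 hv
    refine ⟨i, Subtype.ext hi, fun u hu => ?_⟩
    have := (hs i u).1 hu
    change (u : ℝ) < v
    linarith [hA i]
  have hdet := two_mul_log_det_laplacian_le hloop (fun v : S => (v : ℝ)) hr
  have hle := le_det_laplacian (fun v : S => (v : ℝ)) hr hN ⟨N, hexists N hN le_rfl (Or.inl rfl)⟩
    (fun v : S => (v : ℝ)) ?_ i₀ (by rw [hselim]; simp only [t]; linarith)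
  · have := Real.log_le_log hN hle
    linarith
  · funext v
    have hv0 : 0 < (v : ℝ) := by
      obtain ⟨i, hi⟩ := (hmemS v).1 v.2
      linarith [hbot i, hA i]
    have hvN : (v : ℝ) ≤ N := by
      obtain ⟨i, hi⟩ := (hmemS v).1 v.2
      linarith [htop i]
    have hcurrent : ∀ i, ((incidence ℝ t s (-1))ᵀ *ᵥ fun v : S => (v : ℝ)) i = A i := by
      intro i
      simp only [mulVec, dotProduct, transpose_apply, incidence, add_mul, mul_assoc,
        Finset.sum_add_distrib, ← Finset.mul_sum, sum_ite_some_mul, hselim]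
      simp [t]
    rw [← mulVec_mulVec, funext hcurrent]
    have h := hbal v hv0 hvN
    have hsingle : (Pi.single ⟨N, hexists N hN le_rfl (Or.inl rfl)⟩ N : S → ℝ) v =
        if (v : ℝ) = N then N else 0 := by
      simp [Pi.single_apply, Subtype.ext_iff]
    rw [hsingle, ← h, ← Finset.sum_sub_distrib]
    refine Finset.sum_congr rfl fun i _ => ?_
    simp only [incidence, hs, t, Subtype.ext_iff]
    split_ifs <;> ring

end Dissection

theorem interior_sqTile (x y : ℝ) (a : ℕ) :
    interior (sqTile x y a) = Set.Ioo x (x + a) ×ˢ Set.Ioo y (y + a) := by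
  rw [sqTile, interior_prod_eq, interior_Icc, interior_Icc]

end PuncturedSquare

/-- **Squaring a `2^k × 2^k` square with a unit cell removed.**
Let `N = 2^k` and let `0 ≤ p, q < N`. If the region obtained from `[0,N] × [0,N]` by
removing the interior of the unit cell `[p,p+1] × [q,q+1]` is dissected into `m`
axis-parallel squares with positive integer side lengths, then `τ ^ (m+1) ≥ 2 ^ k`
(where `τ > 1` is the real root of `x³ = x² + 3`); in particular
`m + 1 ≥ k · log_τ 2`. -/
theorem punctured_square_dissection_bound (τ : ℝ) (hτ1 : 1 < τ) (hτ : τ ^ 3 = τ ^ 2 + 3)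
    (k : ℕ) (p q : ℕ) (hp : p < 2 ^ k) (hq : q < 2 ^ k) (m : ℕ)
    (x y : Fin m → ℝ) (a : Fin m → ℕ) (ha : ∀ i, 0 < a i)
    (hsub : ∀ i, sqTile (x i) (y i) (a i) ⊆ puncturedSquare k p q)
    (hdisj : Pairwise fun i j =>
      Disjoint (interior (sqTile (x i) (y i) (a i)))
        (interior (sqTile (x j) (y j) (a j))))
    (hcover : (⋃ i, sqTile (x i) (y i) (a i)) = puncturedSquare k p q) :
    τ ^ (m + 1) ≥ (2 : ℝ) ^ k ∧
      ((m : ℝ) + 1) ≥ k * (Real.log 2 / Real.log τ) := by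
  have hτ0 : 0 < τ := by linarith
  have hτ4 : 12 ≤ τ ^ 4 := by
    have h1 : (1.86 : ℝ) ≤ τ := by
      by_contra! h
      nlinarith [mul_pos hτ0 hτ0]
    have h2 : τ ^ 4 = τ ^ 2 + 3 + 3 * τ := by linear_combination (τ + 1) * hτ
    nlinarith
  have hlogτ : Real.log 12 ≤ 4 * Real.log τ := by
    have := Real.log_le_log (by norm_num) hτ4
    rwa [Real.log_pow] at this
  have hp' : (p : ℝ) + 1 ≤ 2 ^ k := by exact_mod_cast hp
  have hq' : (q : ℝ) + 1 ≤ 2 ^ k := by exact_mod_cast hq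
  have main := four_mul_log_side_le (E := Option (Fin m)) (X := fun o => o.elim (p : ℝ) x)
    (Y := fun o => o.elim (q : ℝ) y) (A := fun o => o.elim (1 : ℝ) fun i => (a i : ℝ))
    (N := 2 ^ k) ?_ (by positivity) ?_ ?_ none rfl
  · rw [Fintype.card_option, Fintype.card_fin, Real.log_pow] at main
    push_cast at main
    have hlog : k * Real.log 2 ≤ ((m : ℝ) + 1) * Real.log τ := by
      have : ((m : ℝ) + 1) * Real.log 12 ≤ ((m : ℝ) + 1) * (4 * Real.log τ) :=
        mul_le_mul_of_nonneg_left hlogτ (by positivity)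
      linarith
    constructor
    · rw [ge_iff_le, ← Real.log_le_log_iff (by positivity) (by positivity), Real.log_pow,
        Real.log_pow]
      push_cast
      exact hlog
    · rw [ge_iff_le, ← mul_div_assoc, div_le_iff₀ (Real.log_pos hτ1)]
      exact hlog
  · rintro (_ | i)
    · exact one_pos
    · exact Nat.cast_pos.2 (ha i)
  · have hhole : ∀ i u v, u ∈ Set.Ioo (x i) (x i + a i) → v ∈ Set.Ioo (y i) (y i + a i) →
        u ∈ Set.Ioo (p : ℝ) (p + 1) → v ∉ Set.Ioo (q : ℝ) (q + 1) := fun i u v hu hv hu' hv' =>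
      (hsub i (Set.mk_mem_prod (Set.Ioo_subset_Icc_self hu) (Set.Ioo_subset_Icc_self hv))).2
        (Set.mk_mem_prod hu' hv')
    rintro (_ | i) (_ | j) hij u v hu hv hu' hv'
    · exact hij rfl
    · exact hhole j u v hu' hv' hu hv
    · exact hhole i u v hu hv hu' hv'
    · have h := hdisj (fun h => hij (congrArg some h) : i ≠ j)
      simp only [interior_sqTile] at h
      exact Set.disjoint_left.1 h (Set.mk_mem_prod hu hv) (Set.mk_mem_prod hu' hv')
  · intro u v
    constructor
    · rintro ⟨hu, hv⟩
      by_cases hin : u ∈ Set.Ioo (p : ℝ) (p + 1) ∧ v ∈ Set.Ioo (q : ℝ) (q + 1)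
      · exact ⟨none, Set.Ioo_subset_Icc_self hin.1, Set.Ioo_subset_Icc_self hin.2⟩
      · have hmem : (u, v) ∈ puncturedSquare k p q := ⟨⟨hu, hv⟩, hin⟩
        rw [← hcover] at hmem
        obtain ⟨i, hi⟩ := Set.mem_iUnion.1 hmem
        exact ⟨some i, hi.1, hi.2⟩
    · rintro ⟨_ | i, hu, hv⟩
      · simp only [Option.elim_none, Set.mem_Icc] at hu hv ⊢
        have hp0 : (0 : ℝ) ≤ p := Nat.cast_nonneg p
        have hq0 : (0 : ℝ) ≤ q := Nat.cast_nonneg q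
        exact ⟨⟨by linarith, by linarith⟩, by linarith, by linarith⟩
      · exact (hsub i (Set.mk_mem_prod hu hv)).1
end
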